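/- Suppose triangle ABC is N-tiled by a tile with sides a, b, c such that: (i) exactly one tile has a vertex at A; (ii) at every boundary vertex of the tiling an odd number of tiles meet; (iii) at every interior vertex an even number of tiles meet; (iv) the numbers of tiles having a vertex at B and at C are both even or both odd. Then there is an assignment of a color, black or white, to each tile such that any two tiles sharing a segment of positive length on their boundaries receive different colors and the tile at A is black; and if M denotes the number of black tiles minus the number of white tiles, then X ± Y + Z = M(a + b + c), where Y is the length of the side of ABC opposite A, X and Z are the lengths of the other two sides, and the sign is + if the number of tiles at B and at C is odd and − if it is even. -/

import Mathlib

open EuclideanGeometry Real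

noncomputable section

/-- A point of the Euclidean plane. -/
abbrev Pt : Type := EuclideanSpace ℝ (Fin 2)

/-- A triangle, given by its three vertices. -/
abbrev Tri : Type := Fin 3 → Pt

/-- A genuine (nondegenerate) triangle. -/
def IsTriangle (T : Tri) : Prop := AffineIndependent ℝ T

/-- The closed triangle (convex hull of the vertices). -/
def triSet (T : Tri) : Set Pt := convexHull ℝ (Set.range T)

/-- Two triangles are congruent iff corresponding distances agree
up to a permutation of the vertices. -/
def CongruentTri (T₁ T₂ : Tri) : Prop :=
  ∃ σ : Equiv.Perm (Fin 3), ∀ i j : Fin 3, dist (T₁ i) (T₁ j) = dist (T₂ (σ i)) (T₂ (σ j))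

/-- An `N`-tiling of the triangle `ABC` by the tile `T`: a family of `N` triangles,
each congruent to `T`, with pairwise disjoint interiors, whose union is the
closed triangle `ABC`. -/
structure IsTiling (N : ℕ) (ABC T : Tri) (tiles : Fin N → Tri) : Prop where
  congr : ∀ i, CongruentTri (tiles i) T
  disj : ∀ i j, i ≠ j → interior (triSet (tiles i)) ∩ interior (triSet (tiles j)) = ∅
  cover : (⋃ i, triSet (tiles i)) = triSet ABC

/-- The interior angle of the triangle `T` at its `k`-th vertex. -/
def triAngle (T : Tri) (k : Fin 3) : ℝ := ∠ (T (k + 1)) (T k) (T (k + 2))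

/-- The side of `T` opposite to the `k`-th vertex. -/
def sideLen (T : Tri) (k : Fin 3) : ℝ := dist (T (k + 1)) (T (k + 2))

/-- `T` has angles `α`, `β`, `γ` (at vertices `0`, `1`, `2`, which are opposite
the sides of lengths `a`, `b`, `c` respectively). -/
def HasAngles (T : Tri) (α β γ : ℝ) : Prop :=
  triAngle T 0 = α ∧ triAngle T 1 = β ∧ triAngle T 2 = γ

/-- Two triangles are similar iff corresponding distances agree up to a
permutation of the vertices and a positive scale factor. -/
def SimilarTri (T₁ T₂ : Tri) : Prop :=
  ∃ r : ℝ, 0 < r ∧ ∃ σ : Equiv.Perm (Fin 3),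
    ∀ i j : Fin 3, dist (T₁ i) (T₁ j) = r * dist (T₂ (σ i)) (T₂ (σ j))

open scoped Classical

/-- The set of tiles having a vertex at the point `P`. -/
noncomputable def tilesAt {N : ℕ} (tiles : Fin N → Tri) (P : Pt) : Finset (Fin N) :=
  Finset.univ.filter fun i => ∃ k : Fin 3, tiles i k = P

/-- The interior angle contributed by tile `i` at the point `P` (zero if `P`
is not a vertex of tile `i`). -/
noncomputable def tileAngleAt {N : ℕ} (tiles : Fin N → Tri) (i : Fin N) (P : Pt) : ℝ :=
  ∑ k : Fin 3, if tiles i k = P then triAngle (tiles i) k else 0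

/-- The sum of the interior angles of the tiles having a vertex at `P`. -/
noncomputable def angleSumAt {N : ℕ} (tiles : Fin N → Tri) (P : Pt) : ℝ :=
  ∑ i, tileAngleAt tiles i P

/-- `P` is a vertex of the tiling: a vertex of at least one tile. -/
def IsTilingVertex {N : ℕ} (tiles : Fin N → Tri) (P : Pt) : Prop :=
  ∃ (i : Fin N) (k : Fin 3), tiles i k = P

/-- Tiles `i` and `j` share a segment of positive length on their boundaries. -/
def SharesEdgeSegment {N : ℕ} (tiles : Fin N → Tri) (i j : Fin N) : Prop :=
  ∃ P Q : Pt, P ≠ Q ∧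
    segment ℝ P Q ⊆ frontier (triSet (tiles i)) ∩ frontier (triSet (tiles j))

abbrev Bas : Type := AffineBasis (Fin 3) ℝ Pt

def co (b : Bas) (k : Fin 3) (p : Pt) : ℝ := b.coord k p
def li (b : Bas) (k : Fin 3) : Pt →ₗ[ℝ] ℝ := (b.coord k).linear

lemma co_add (b : Bas) (k : Fin 3) (p d : Pt) : co b k (p + d) = co b k p + li b k d := by
  have := (b.coord k).map_vadd p d
  simp only [vadd_eq_add] at this
  rw [co, co, li, add_comm p d, this, add_comm]

lemma co_line (b : Bas) (k : Fin 3) (p d : Pt) (t : ℝ) :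
    co b k (p + t • d) = co b k p + t * li b k d := by
  rw [co_add, map_smul, smul_eq_mul]

lemma li_sub (b : Bas) (k : Fin 3) (p q : Pt) : li b k (q - p) = co b k q - co b k p := by
  have := co_add b k p (q - p)
  rw [add_sub_cancel] at this
  linarith

lemma co_self (b : Bas) (k : Fin 3) : co b k (b k) = 1 := b.coord_apply_eq k
lemma co_ne (b : Bas) {k l : Fin 3} (h : k ≠ l) : co b k (b l) = 0 := b.coord_apply_ne h

lemma co_sum (b : Bas) (p : Pt) : co b 0 p + co b 1 p + co b 2 p = 1 := by
  have := b.sum_coord_apply_eq_one p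
  rw [Fin.sum_univ_three] at this
  exact this

lemma co_sum' (b : Bas) (k : Fin 3) (p : Pt) :
    co b k p + co b (k+1) p + co b (k+2) p = 1 := by
  have := co_sum b p
  fin_cases k <;> simp <;> linarith

lemma li_sum' (b : Bas) (k : Fin 3) (d : Pt) :
    li b k d + li b (k+1) d + li b (k+2) d = 0 := by
  have h1 := co_sum' b k 0
  have h2 := co_sum' b k (0 + d)
  simp only [co_add] at h2
  linarith

lemma co_repr (b : Bas) (k : Fin 3) (p : Pt) :
    p = co b k p • b k + co b (k+1) p • b (k+1) + co b (k+2) p • b (k+2) := by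
  have := b.linear_combination_coord_eq_self p
  rw [Fin.sum_univ_three] at this
  change co b 0 p • b 0 + co b 1 p • b 1 + co b 2 p • b 2 = p at this
  fin_cases k <;> simp
  · exact this.symm
  · conv_lhs => rw [← this]
    abel
  · conv_lhs => rw [← this]
    abel

lemma li_repr (b : Bas) (k : Fin 3) (d : Pt) :
    d = li b k d • b k + li b (k+1) d • b (k+1) + li b (k+2) d • b (k+2) := by
  have h1 := co_repr b k 0
  have h2 := co_repr b k (0 + d)
  simp only [co_add] at h2
  rw [zero_add] at h2
  calc d = d - 0 := by simp
    _ = _ := by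
      conv_lhs => rw [h2]
      conv_lhs => enter [2]; rw [h1]
      module

lemma co_ext (b : Bas) {p q : Pt} (h : ∀ k, co b k p = co b k q) : p = q := b.ext_elem h

/-- strict interior -/
def In (b : Bas) (p : Pt) : Prop := ∀ k, 0 < co b k p
def Cl (b : Bas) (p : Pt) : Prop := ∀ k, 0 ≤ co b k p

def Dir (b : Bas) (p d : Pt) : Prop :=
  ∀ k, 0 < co b k p ∨ (co b k p = 0 ∧ 0 < li b k d)

lemma In.cl {b : Bas} {p : Pt} (h : In b p) : Cl b p := fun k => (h k).le
lemma Dir.cl {b : Bas} {p d : Pt} (h : Dir b p d) : Cl b p := fun k => by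
  rcases h k with h | h
  · exact h.le
  · exact h.1.ge
lemma In.dir {b : Bas} {p : Pt} (h : In b p) (d : Pt) : Dir b p d := fun k => Or.inl (h k)

lemma In.eventually {b : Bas} {p : Pt} (h : In b p) (d : Pt) :
    ∀ᶠ t : ℝ in nhds 0, In b (p + t • d) := by
  unfold In
  rw [Filter.eventually_all]
  intro k
  simp only [co_line]
  have : Continuous fun t : ℝ => co b k p + t * li b k d := by fun_prop
  have h2 := this.tendsto 0
  simp only [zero_mul, add_zero] at h2
  exact h2.eventually (lt_mem_nhds (h k))

lemma Dir.eventually {b : Bas} {p d : Pt} (h : Dir b p d) :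
    ∀ᶠ t : ℝ in nhdsWithin 0 (Set.Ioi 0), In b (p + t • d) := by
  unfold In
  rw [Filter.eventually_all]
  intro k
  simp only [co_line]
  rcases h k with h | h
  · have : Continuous fun t : ℝ => co b k p + t * li b k d := by fun_prop
    have h2 := this.tendsto 0
    simp only [zero_mul, add_zero] at h2
    exact (h2.eventually (lt_mem_nhds h)).filter_mono nhdsWithin_le_nhds
  · filter_upwards [self_mem_nhdsWithin] with t ht
    have : (0:ℝ) < t := ht
    rw [h.1]
    have := mul_pos this h.2
    linarith

lemma not_dir_eventually {b : Bas} {p d : Pt} (h : ¬ Dir b p d) (hd : ∀ k, li b k d ≠ 0) :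
    ∀ᶠ t : ℝ in nhdsWithin 0 (Set.Ioi 0), ¬ Cl b (p + t • d) := by
  unfold Dir at h
  push Not at h
  obtain ⟨k, h1, h2⟩ := h
  suffices ∀ᶠ t : ℝ in nhdsWithin 0 (Set.Ioi 0), co b k (p + t • d) < 0 by
    filter_upwards [this] with t ht hc
    exact absurd (hc k) (not_le.2 ht)
  simp only [co_line]
  rcases h1.lt_or_eq with h1 | h1
  · have : Continuous fun t : ℝ => co b k p + t * li b k d := by fun_prop
    have h2 := this.tendsto 0
    simp only [zero_mul, add_zero] at h2
    exact (h2.eventually (gt_mem_nhds h1)).filter_mono nhdsWithin_le_nhds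
  · filter_upwards [self_mem_nhdsWithin] with t ht
    have h0 : (0:ℝ) < t := ht
    have h3 := lt_of_le_of_ne (h2 h1) (hd k)
    rw [h1]
    have := mul_neg_of_pos_of_neg h0 h3
    linarith

/-- convexity -/
lemma co_comb (b : Bas) (k : Fin 3) (p q : Pt) (t : ℝ) :
    co b k (p + t • (q - p)) = (1 - t) * co b k p + t * co b k q := by
  rw [co_line, li_sub]; ring

lemma In.comb {b : Bas} {p q : Pt} (hp : Cl b p) (hq : In b q) {t : ℝ} (h0 : 0 < t) (h1 : t ≤ 1) :
    In b (p + t • (q - p)) := fun k => by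
  rw [co_comb]
  have := mul_pos h0 (hq k)
  have := mul_nonneg (sub_nonneg.2 h1) (hp k)
  linarith

lemma Cl.comb {b : Bas} {p q : Pt} (hp : Cl b p) (hq : Cl b q) {t : ℝ} (h0 : 0 ≤ t) (h1 : t ≤ 1) :
    Cl b (p + t • (q - p)) := fun k => by
  rw [co_comb]
  have := mul_nonneg h0 (hq k)
  have := mul_nonneg (sub_nonneg.2 h1) (hp k)
  linarith

lemma exists_In (b : Bas) : ∃ z, In b z := by
  refine ⟨b 0 + (1/3 : ℝ) • ((b 1 - b 0) + (b 2 - b 0)), fun k => ?_⟩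
  rw [co_line, map_add, li_sub, li_sub]
  fin_cases k <;> simp [co_self, co_ne] <;> norm_num

/-- If `p + t d` interior for some `t > 0` and `p` in the closed triangle then `Dir`. -/
lemma dir_of_In {b : Bas} {p d : Pt} (hp : Cl b p) {t : ℝ} (ht : 0 < t) (h : In b (p + t • d)) :
    Dir b p d := fun k => by
  rcases (hp k).lt_or_eq with h1 | h1
  · exact Or.inl h1
  · right
    refine ⟨h1.symm, ?_⟩
    have := h k
    rw [co_line, ← h1] at this
    exact (pos_iff_pos_of_mul_pos (by simpa using this)).1 ht

structure Til {N : ℕ} (b : Fin N → Bas) (c : Bas) : Prop where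
  disj : ∀ i j p, In (b i) p → In (b j) p → i = j
  cover : ∀ p, Cl c p ↔ ∃ i, Cl (b i) p
  sub : ∀ i p, In (b i) p → In c p

section
variable {N : ℕ} {b : Fin N → Bas} {c : Bas}

lemma Til.disj' (H : Til b c) {i j : Fin N} {p : Pt} (h1 : In (b i) p) (h2 : Cl (b j) p) :
    i = j := by
  obtain ⟨z, hz⟩ := exists_In (b j)
  have h3 := (h1.eventually (z - p)).filter_mono (nhdsWithin_le_nhds (s := Set.Ioi 0))
  have h4 : ∀ᶠ t : ℝ in nhdsWithin 0 (Set.Ioi 0), t ∈ Set.Ioc (0:ℝ) 1 :=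
    Ioc_mem_nhdsGT one_pos
  obtain ⟨t, h5, h6⟩ := (h3.and h4).exists
  exact H.disj i j _ h5 (In.comb h2 hz h6.1 h6.2)

lemma Til.dir_unique (H : Til b c) {i j : Fin N} {p d : Pt} (h1 : Dir (b i) p d)
    (h2 : Dir (b j) p d) : i = j := by
  obtain ⟨t, h5, h6⟩ := (h1.eventually.and h2.eventually).exists
  exact H.disj i j _ h5 h6

lemma Til.dir_sub (H : Til b c) {i : Fin N} {p d : Pt} (h1 : Dir (b i) p d) : Dir c p d := by
  have hc : Cl c p := (H.cover p).2 ⟨i, h1.cl⟩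
  have h4 : ∀ᶠ t : ℝ in nhdsWithin 0 (Set.Ioi 0), t ∈ Set.Ioc (0:ℝ) 1 :=
    Ioc_mem_nhdsGT one_pos
  obtain ⟨t, h5, h6⟩ := (h1.eventually.and h4).exists
  exact dir_of_In hc h6.1 (H.sub i _ h5)

lemma Til.dir_exists (H : Til b c) {p d : Pt} (hd : ∀ i k, li (b i) k d ≠ 0) (h : Dir c p d) :
    ∃ i, Dir (b i) p d := by
  by_contra hne
  push Not at hne
  have h1 : ∀ᶠ t : ℝ in nhdsWithin 0 (Set.Ioi 0), ∀ i, ¬ Cl (b i) (p + t • d) := by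
    rw [Filter.eventually_all]
    exact fun i => not_dir_eventually (hne i) (hd i)
  obtain ⟨t, h5, h6⟩ := (h1.and h.eventually).exists
  obtain ⟨i, hi⟩ := (H.cover _).1 h6.cl
  exact h5 i hi

end

def dth (a : ℝ) : Pt := !₂[cos a, sin a]

lemma dth_lin (l : Pt →ₗ[ℝ] ℝ) (a : ℝ) :
    l (dth a) = cos a * l !₂[1, 0] + sin a * l !₂[0, 1] := by
  have : dth a = cos a • (!₂[1, 0] : Pt) + sin a • (!₂[0, 1] : Pt) := by
    ext i
    fin_cases i <;> simp [dth]
  rw [this, map_add, map_smul, map_smul, smul_eq_mul, smul_eq_mul]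

lemma lin_sin (l : Pt →ₗ[ℝ] ℝ) (a : ℝ) (h : l (dth a) = 0) :
    ∃ C, ∀ θ, l (dth θ) = C * sin (θ - a) := by
  refine ⟨-l !₂[1, 0] * sin a + l !₂[0, 1] * cos a, fun θ => ?_⟩
  rw [dth_lin] at h ⊢
  rw [sin_sub]
  generalize l !₂[1, 0] = x at *
  generalize l !₂[0, 1] = y at *
  linear_combination (cos θ * x + sin θ * y) * (-(sin_sq_add_cos_sq a)) +
    h * (cos a * cos θ + sin a * sin θ)

lemma polar (v : Pt) (hv : v ≠ 0) (a : ℝ) :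
    ∃ r : ℝ, 0 < r ∧ ∃ δ ∈ Set.Ioc (-π) π, v = r • dth (a + δ) := by
  set z : ℂ := ⟨v 0 * cos a + v 1 * sin a, -v 0 * sin a + v 1 * cos a⟩ with hz
  have h1 := Complex.norm_mul_cos_arg z
  have h2 := Complex.norm_mul_sin_arg z
  simp only [hz] at h1 h2
  rw [← hz] at h1 h2
  have hc := sin_sq_add_cos_sq a
  have e0 : v 0 = ‖z‖ * cos (a + z.arg) := by
    rw [cos_add]
    linear_combination (-v 0) * hc - h1 * cos a + h2 * sin a
  have e1 : v 1 = ‖z‖ * sin (a + z.arg) := by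
    rw [sin_add]
    linear_combination (-v 1) * hc - h1 * sin a - h2 * cos a
  refine ⟨‖z‖, ?_, z.arg, Complex.arg_mem_Ioc z, ?_⟩
  · rw [norm_pos_iff]
    intro h0
    apply hv
    rw [h0] at e0 e1
    ext i
    fin_cases i
    · simpa using e0
    · simpa using e1
  · ext i
    fin_cases i
    · simpa [dth] using e0
    · simpa [dth] using e1

lemma base_int (a δ : ℝ) (h0 : 0 < δ) (h1 : δ ≤ π) :
    ∫ θ in (-π)..π, (if 0 < sin (θ - a) ∧ sin (θ - (a + δ)) < 0 then (1:ℝ) else 0) = δ := by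
  set h : ℝ → ℝ := fun τ => if 0 < sin τ ∧ sin (τ - δ) < 0 then (1:ℝ) else 0 with hh
  have per : Function.Periodic h (2 * π) := by
    intro x
    simp only [hh]
    rw [sin_add_two_pi, show x + 2 * π - δ = (x - δ) + 2 * π by ring, sin_add_two_pi]
  have e1 : ∀ θ, (if 0 < sin (θ - a) ∧ sin (θ - (a + δ)) < 0 then (1:ℝ) else 0) = h (θ - a) := by
    intro θ
    simp only [hh]
    rw [sub_add_eq_sub_sub]
  simp only [e1]
  rw [intervalIntegral.integral_comp_sub_right (fun x => h x) a]
  have e2 := per.intervalIntegral_add_eq (-π - a) (-π)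
  rw [show -π - a + 2 * π = π - a by ring, show -π + 2 * π = π by ring] at e2
  rw [e2, intervalIntegral.integral_of_le (by linarith [pi_pos])]
  have e3 : ∀ τ ∈ Set.Ioc (-π) π, h τ = (Set.Ioo 0 δ).indicator (fun _ => (1:ℝ)) τ := by
    intro τ hτ
    simp only [hh, Set.indicator_apply]
    refine if_congr ?_ rfl rfl
    constructor
    · rintro ⟨h2, h3⟩
      have p1 : 0 < τ := by
        by_contra hc
        exact absurd h2 (not_lt.2 (sin_nonpos_of_nonpos_of_neg_pi_le (not_lt.1 hc) hτ.1.le))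
      refine ⟨p1, ?_⟩
      by_contra hc
      exact absurd h3 (not_lt.2 (sin_nonneg_of_nonneg_of_le_pi (by linarith) (by linarith [hτ.2])))
    · rintro ⟨h2, h3⟩
      exact ⟨sin_pos_of_pos_of_lt_pi h2 (by linarith),
        sin_neg_of_neg_of_neg_pi_lt (by linarith) (by linarith)⟩
  have hsub : Set.Ioo 0 δ ⊆ Set.Ioc (-π) π :=
    fun x hx => ⟨by linarith [hx.1, pi_pos], by linarith [hx.2]⟩
  rw [MeasureTheory.setIntegral_congr_fun measurableSet_Ioc e3,
    MeasureTheory.setIntegral_indicator measurableSet_Ioo,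
    Set.inter_eq_right.2 hsub]
  simp [h0.le]

/-- angular measure of `b` at `P` -/
def ang (b : Bas) (P : Pt) : ℝ := ∫ θ in (-π)..π, (if Dir b P (dth θ) then (1:ℝ) else 0)

def Flat (b : Bas) (P : Pt) : Prop :=
  ∃ k, co b k P = 0 ∧ 0 < co b (k+1) P ∧ 0 < co b (k+2) P

lemma forall_cyc {p : Fin 3 → Prop} (k : Fin 3) : (∀ l, p l) ↔ p k ∧ p (k+1) ∧ p (k+2) := by
  rw [Fin.forall_fin_succ, Fin.forall_fin_two]
  fin_cases k <;> simp <;> tauto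

lemma ang_In {b : Bas} {P : Pt} (h : In b P) : ang b P = 2 * π := by
  unfold ang
  simp only [h.dir, if_true]
  simp; ring

lemma ang_out {b : Bas} {P : Pt} (h : ¬ Cl b P) : ang b P = 0 := by
  unfold ang
  have : ∀ d, ¬ Dir b P d := fun d hd => h hd.cl
  simp [this]

lemma ang_flat {b : Bas} {P : Pt} (h : Flat b P) : ang b P = π := by
  obtain ⟨k, h0, h1, h2⟩ := h
  have hw : b (k+1) - b (k+2) ≠ 0 := by
    intro hw
    have := b.ind.injective (sub_eq_zero.1 hw)
    fin_cases k <;> simp at this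
  obtain ⟨r, hr, a, -, hv⟩ := polar _ hw 0
  rw [zero_add] at hv
  have hl : li b k (dth a) = 0 := by
    have : li b k (b (k+1) - b (k+2)) = 0 := by
      rw [li_sub, co_ne, co_ne, sub_zero]
      all_goals fin_cases k <;> simp
    rw [hv, map_smul, smul_eq_mul] at this
    exact (mul_eq_zero.1 this).resolve_left hr.ne'
  obtain ⟨C, hC⟩ := lin_sin _ _ hl
  have hD : ∀ θ, Dir b P (dth θ) ↔ 0 < C * sin (θ - a) := by
    intro θ
    unfold Dir
    rw [forall_cyc k, ← hC]
    simp [h0, h1, h2]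
  have hC0 : C ≠ 0 := by
    rintro rfl
    have hz : ∀ v, li b k v = 0 := by
      intro v
      by_cases hv0 : v = 0
      · simp [hv0]
      · obtain ⟨r, hr, a, -, hv⟩ := polar _ hv0 0
        rw [hv, map_smul, hC]; simp
    have := hz (b k - b (k+1))
    rw [li_sub, co_self, co_ne] at this
    · norm_num at this
    · fin_cases k <;> simp
  unfold ang
  simp only [hD]
  rcases hC0.lt_or_gt with hC0 | hC0
  · refine Eq.trans ?_ (base_int (a - π) π pi_pos le_rfl)
    congr 1
    ext θ
    refine if_congr ?_ rfl rfl
    rw [show θ - (a - π) = (θ - a) + π by ring, show θ - (a - π + π) = θ - a by ring, sin_add_pi]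
    constructor
    · intro h
      have := neg_of_mul_pos_right h hC0.le
      exact ⟨by linarith, this⟩
    · intro h
      exact mul_pos_of_neg_of_neg hC0 h.2
  · refine Eq.trans ?_ (base_int a π pi_pos le_rfl)
    congr 1
    ext θ
    refine if_congr ?_ rfl rfl
    rw [show θ - (a + π) = (θ - a) - π by ring, sin_sub_pi]
    constructor
    · intro h
      have := pos_of_mul_pos_right h hC0.le
      exact ⟨this, by linarith⟩
    · intro h
      exact mul_pos hC0 h.1

lemma angle_dth (a δ : ℝ) (h : |δ| ≤ π) :
    InnerProductGeometry.angle (dth a) (dth (a + δ)) = |δ| := by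
  have hn : ∀ x, ‖dth x‖ = 1 := by
    intro x
    simp [dth, EuclideanSpace.norm_eq, cos_sq_add_sin_sq]
  unfold InnerProductGeometry.angle
  rw [hn, hn]
  have : inner ℝ (dth a) (dth (a + δ)) = cos |δ| := by
    rw [cos_abs]
    simp only [dth, PiLp.inner_apply, Fin.sum_univ_two]
    simp
    have := cos_sub (a + δ) a
    rw [add_sub_cancel_left] at this
    linarith
  rw [this, mul_one, div_one]
  exact arccos_cos (abs_nonneg _) h

lemma ang_vertex (b : Bas) (k : Fin 3) : ang b (b k) = triAngle b k := by
  have n1 : k + 1 ≠ k := by fin_cases k <;> simp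
  have n2 : k + 2 ≠ k := by fin_cases k <;> simp
  have n3 : k + 1 ≠ k + 2 := by fin_cases k <;> simp
  obtain ⟨r1, hr1, a1, -, hv1⟩ := polar (b (k+1) - b k)
    (fun h => n1 (b.ind.injective (sub_eq_zero.1 h))) 0
  rw [zero_add] at hv1
  obtain ⟨r2, hr2, δ, hδ, hv2⟩ := polar (b (k+2) - b k)
    (fun h => n2 (b.ind.injective (sub_eq_zero.1 h))) a1
  have l11 : li b (k+1) (b (k+1) - b k) = 1 := by rw [li_sub, co_self, co_ne _ n1, sub_zero]
  have l12 : li b (k+1) (b (k+2) - b k) = 0 := by rw [li_sub, co_ne _ n3, co_ne _ n1, sub_zero]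
  have l21 : li b (k+2) (b (k+1) - b k) = 0 := by rw [li_sub, co_ne _ n3.symm, co_ne _ n2, sub_zero]
  have l22 : li b (k+2) (b (k+2) - b k) = 1 := by rw [li_sub, co_self, co_ne _ n2, sub_zero]
  rw [hv1, map_smul, smul_eq_mul] at l11 l21
  rw [hv2, map_smul, smul_eq_mul] at l12 l22
  obtain ⟨C1, hC1⟩ := lin_sin _ _ ((mul_eq_zero.1 l12).resolve_left hr2.ne')
  obtain ⟨C2, hC2⟩ := lin_sin _ _ ((mul_eq_zero.1 l21).resolve_left hr1.ne')
  rw [hC1, show a1 - (a1 + δ) = -δ by ring, sin_neg] at l11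
  rw [hC2, add_sub_cancel_left] at l22
  have hD : ∀ θ, Dir b (b k) (dth θ) ↔ 0 < C1 * sin (θ - (a1 + δ)) ∧ 0 < C2 * sin (θ - a1) := by
    intro θ
    unfold Dir
    rw [forall_cyc k, ← hC1, ← hC2]
    simp [co_self, co_ne _ n1, co_ne _ n2]
  have hang : triAngle b k = |δ| := by
    unfold triAngle EuclideanGeometry.angle
    rw [vsub_eq_sub, vsub_eq_sub, hv1, hv2, InnerProductGeometry.angle_smul_left_of_pos _ _ hr1,
      InnerProductGeometry.angle_smul_right_of_pos _ _ hr2, angle_dth]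
    exact abs_le.2 ⟨hδ.1.le, hδ.2⟩
  rw [hang]
  unfold ang
  simp only [hD]
  rcases lt_trichotomy δ 0 with h | h | h
  · have hs : sin δ < 0 := sin_neg_of_neg_of_neg_pi_lt h hδ.1
    have hC1p : 0 < C1 := by
      by_contra hc
      have : 0 ≤ r1 * ((-C1) * (-sin δ)) :=
        mul_nonneg hr1.le (mul_nonneg (by linarith) (by linarith))
      linarith
    have hC2n : C2 < 0 := by
      by_contra hc
      have : 0 ≤ r2 * (C2 * (-sin δ)) :=
        mul_nonneg hr2.le (mul_nonneg (by linarith) (by linarith))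
      linarith
    rw [abs_of_neg h]
    refine Eq.trans ?_ (base_int (a1 + δ) (-δ) (by linarith) (by linarith [hδ.1]))
    congr 1
    ext θ
    refine if_congr ?_ rfl rfl
    rw [show a1 + δ + -δ = a1 by ring, mul_pos_iff_of_pos_left hC1p]
    refine and_congr_right fun _ => ?_
    exact ⟨fun h => neg_of_mul_pos_right h hC2n.le, fun h => mul_pos_of_neg_of_neg hC2n h⟩
  · rw [h] at l22
    simp at l22
  · have hpi : δ ≠ π := by
      rintro rfl
      simp at l22
    have hs : 0 < sin δ := sin_pos_of_pos_of_lt_pi h (lt_of_le_of_ne hδ.2 hpi)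
    have hC1p : C1 < 0 := by
      by_contra hc
      have : 0 ≤ r1 * (C1 * sin δ) :=
        mul_nonneg hr1.le (mul_nonneg (by linarith) (by linarith))
      linarith
    have hC2n : 0 < C2 := by
      by_contra hc
      have : 0 ≤ r2 * ((-C2) * (sin δ)) :=
        mul_nonneg hr2.le (mul_nonneg (by linarith) (by linarith))
      linarith
    rw [abs_of_pos h]
    refine Eq.trans ?_ (base_int a1 δ h hδ.2)
    congr 1
    ext θ
    refine if_congr ?_ rfl rfl
    rw [mul_pos_iff_of_pos_left hC2n, and_comm]
    refine and_congr_right fun _ => ?_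
    exact ⟨fun h => neg_of_mul_pos_right h hC1p.le, fun h => mul_pos_of_neg_of_neg hC1p h⟩

lemma cl_cases {b : Bas} {P : Pt} (h : Cl b P) : In b P ∨ Flat b P ∨ ∃ k, b k = P := by
  by_cases hI : In b P
  · exact Or.inl hI
  right
  unfold In at hI
  push Not at hI
  obtain ⟨k, hk⟩ := hI
  have h0 : co b k P = 0 := le_antisymm hk (h k)
  have hs := co_sum' b k P
  have n1 : k + 1 ≠ k := by fin_cases k <;> simp
  have n2 : k + 2 ≠ k := by fin_cases k <;> simp
  have n3 : k + 1 ≠ k + 2 := by fin_cases k <;> simp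
  rcases (h (k+1)).lt_or_eq with h1 | h1
  · rcases (h (k+2)).lt_or_eq with h2 | h2
    · exact Or.inl ⟨k, h0, h1, h2⟩
    · right
      refine ⟨k+1, co_ext b ((forall_cyc k).2 ⟨?_, ?_, ?_⟩)⟩
      · rw [co_ne _ n1.symm, h0]
      · rw [co_self]; linarith
      · rw [co_ne _ n3.symm, h2]
  · right
    refine ⟨k+2, co_ext b ((forall_cyc k).2 ⟨?_, ?_, ?_⟩)⟩
    · rw [co_ne _ n2.symm, h0]
    · rw [co_ne _ n3, h1]
    · rw [co_self]; linarith

lemma Flat.not_In {b : Bas} {P : Pt} (h : Flat b P) : ¬ In b P := by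
  obtain ⟨k, h0, -⟩ := h
  exact fun hI => (hI k).ne' h0

lemma Flat.cl {b : Bas} {P : Pt} (h : Flat b P) : Cl b P := by
  obtain ⟨k, h0, h1, h2⟩ := h
  exact (forall_cyc k).2 ⟨h0.ge, h1.le, h2.le⟩

lemma vertex_not_In (b : Bas) (k : Fin 3) : ¬ In b (b k) := by
  intro h
  have := h (k+1)
  rw [co_ne] at this
  · exact lt_irrefl _ this
  · fin_cases k <;> simp

lemma vertex_cl (b : Bas) (k : Fin 3) : Cl b (b k) := by
  intro l
  by_cases h : l = k
  · rw [h, co_self]; norm_num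
  · rw [co_ne _ h]

lemma vertex_not_Flat (b : Bas) (k : Fin 3) : ¬ Flat b (b k) := by
  rintro ⟨l, h0, h1, h2⟩
  have hk : l ≠ k := by
    rintro rfl
    rw [co_self] at h0
    norm_num at h0
  have h1' : l + 1 = k := by
    by_contra h
    rw [co_ne _ h] at h1
    exact lt_irrefl _ h1
  have h2' : l + 2 = k := by
    by_contra h
    rw [co_ne _ h] at h2
    exact lt_irrefl _ h2
  rw [← h2'] at h1'
  revert h1'
  fin_cases l <;> simp

lemma flat_dir {b : Bas} {P u : Pt} (h : Flat b P) (hu : ∀ k, li b k u ≠ 0) :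
    (Dir b P u ∧ ¬ Dir b P (-u)) ∨ (¬ Dir b P u ∧ Dir b P (-u)) := by
  obtain ⟨k, h0, h1, h2⟩ := h
  unfold Dir
  rw [forall_cyc k, forall_cyc k]
  simp only [h0, h1, h2, map_neg]
  rcases (hu k).lt_or_gt with h | h
  · right; simp [h, h.le]
  · left; simp [h, h.le]

lemma not_both_dir {b : Bas} {P u : Pt} (h : ¬ In b P) : ¬ (Dir b P u ∧ Dir b P (-u)) := by
  rintro ⟨h1, h2⟩
  apply h
  intro k
  rcases h1 k with h3 | h3
  · exact h3
  · rcases h2 k with h4 | h4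
    · exact h4
    · rw [map_neg] at h4
      linarith [h3.2, h4.2]

lemma ang_integrable (b : Bas) (P : Pt) :
    IntervalIntegrable (fun θ => if Dir b P (dth θ) then (1:ℝ) else 0) MeasureTheory.volume (-π) π := by
  have hm : MeasurableSet {θ | Dir b P (dth θ)} := by
    unfold Dir
    have hc : ∀ k, Continuous fun θ => li b k (dth θ) := by
      intro k
      simp only [dth_lin]
      fun_prop
    simp only [Set.ofPred_forall]
    refine MeasurableSet.iInter fun k => ?_
    exact (MeasurableSet.const _).union
      ((MeasurableSet.const _).inter (measurableSet_lt measurable_const (hc k).measurable))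
  have : (fun θ => if Dir b P (dth θ) then (1:ℝ) else 0)
      = {θ | Dir b P (dth θ)}.indicator (fun _ => 1) := by
    ext θ; simp [Set.indicator_apply]
  rw [this, intervalIntegrable_iff]
  exact MeasureTheory.IntegrableOn.indicator (by simp) hm

lemma li_dth_countable (b : Bas) (k : Fin 3) : {θ | li b k (dth θ) = 0}.Countable := by
  by_cases h : ∃ a, li b k (dth a) = 0
  · obtain ⟨a, ha⟩ := h
    obtain ⟨C, hC⟩ := lin_sin _ _ ha
    have hC0 : C ≠ 0 := by
      rintro rfl
      have hz : ∀ v, li b k v = 0 := by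
        intro v
        by_cases hv0 : v = 0
        · simp [hv0]
        · obtain ⟨r, hr, a, -, hv⟩ := polar _ hv0 0
          rw [hv, map_smul, hC]; simp
      have := hz (b k - b (k+1))
      rw [li_sub, co_self, co_ne] at this
      · norm_num at this
      · fin_cases k <;> simp
    refine (Set.countable_range fun n : ℤ => a + n * π).mono ?_
    intro θ hθ
    rw [Set.mem_ofPred_eq, hC, mul_eq_zero, or_iff_right hC0, sin_eq_zero_iff] at hθ
    obtain ⟨n, hn⟩ := hθ
    exact ⟨n, by simp only; linarith⟩
  · push Not at h
    have : {θ | li b k (dth θ) = 0} = ∅ := by ext θ; simp [h θ]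
    rw [this]; exact Set.countable_empty

section
variable {N : ℕ} {b : Fin N → Bas} {c : Bas}

lemma Til.dir_count (H : Til b c) {p d : Pt} (hd : ∀ i k, li (b i) k d ≠ 0)
    {R : Type*} [AddCommMonoidWithOne R] :
    ∑ i, (if Dir (b i) p d then (1:R) else 0) = if Dir c p d then 1 else 0 := by
  split_ifs with h
  · obtain ⟨i, hi⟩ := H.dir_exists hd h
    rw [Finset.sum_eq_single i]
    · simp [hi]
    · intro j _ hj
      rw [if_neg]
      exact fun h2 => hj (H.dir_unique h2 hi)
    · simp
  · refine Finset.sum_eq_zero fun i _ => ?_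
    rw [if_neg]
    exact fun h2 => h (H.dir_sub h2)

lemma Til.ang_sum (H : Til b c) (P : Pt) : ∑ i, ang (b i) P = ang c P := by
  unfold ang
  rw [← intervalIntegral.integral_finsetSum fun i _ => ang_integrable (b i) P]
  apply intervalIntegral.integral_congr_ae
  have hc : (⋃ i, ⋃ k, {θ | li (b i) k (dth θ) = 0}).Countable :=
    Set.countable_iUnion fun i => Set.countable_iUnion fun k => li_dth_countable _ _
  have := (hc.ae_notMem MeasureTheory.volume)
  filter_upwards [this] with θ hθ _
  simp only [Set.mem_iUnion, not_exists, Set.mem_ofPred_eq] at hθ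
  exact H.dir_count hθ

lemma Til.not_In_vertex (H : Til b c) {P : Pt} (hP : ∃ i k, b i k = P) (i : Fin N) :
    ¬ In (b i) P := by
  obtain ⟨j, k, rfl⟩ := hP
  intro h
  have := H.disj' h (vertex_cl (b j) k)
  subst this
  exact vertex_not_In _ _ h

lemma tileAngle_eq (i : Fin N) (k : Fin 3) :
    tileAngleAt (fun i => ⇑(b i)) i (b i k) = triAngle (b i) k := by
  unfold tileAngleAt
  rw [Finset.sum_eq_single k]
  · simp
  · intro l _ hl
    rw [if_neg]
    exact fun h => hl ((b i).ind.injective h)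
  · simp

lemma Til.angle_total (H : Til b c) {P : Pt} (hP : ∃ i k, b i k = P) :
    angleSumAt (fun i => ⇑(b i)) P + ∑ i, (if Flat (b i) P then π else 0) = ang c P := by
  rw [← H.ang_sum, angleSumAt, ← Finset.sum_add_distrib]
  refine Finset.sum_congr rfl fun i _ => ?_
  by_cases hc : Cl (b i) P
  · rcases cl_cases hc with h | h | ⟨k, rfl⟩
    · exact absurd h (H.not_In_vertex hP i)
    · rw [if_pos h, ang_flat h]
      have : tileAngleAt (fun i => ⇑(b i)) i P = 0 := by
        refine Finset.sum_eq_zero fun k _ => ?_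
        rw [if_neg]
        rintro rfl
        exact vertex_not_Flat _ _ h
      linarith
    · rw [tileAngle_eq, ang_vertex, if_neg (vertex_not_Flat _ _), add_zero]
  · rw [ang_out hc, if_neg fun h => hc h.cl, add_zero]
    refine Finset.sum_eq_zero fun k _ => ?_
    rw [if_neg]
    rintro rfl
    exact hc (vertex_cl _ _)

lemma Til.angle_pos (_ : Til b c) {P : Pt} (hP : ∃ i k, b i k = P) :
    0 < angleSumAt (fun i => ⇑(b i)) P := by
  have hnn : ∀ i, 0 ≤ tileAngleAt (fun i => ⇑(b i)) i P := by
    intro i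
    refine Finset.sum_nonneg fun k _ => ?_
    split_ifs
    · exact EuclideanGeometry.angle_nonneg _ _ _
    · exact le_rfl
  obtain ⟨i, k, rfl⟩ := hP
  refine Finset.sum_pos' (fun i _ => hnn i) ⟨i, Finset.mem_univ _, ?_⟩
  rw [tileAngle_eq]
  have h0 := EuclideanGeometry.angle_nonneg (b i (k+1)) (b i k) (b i (k+2))
  refine lt_of_le_of_ne h0 fun h => ?_
  have hc : Collinear ℝ ({b i (k+1), b i k, b i (k+2)} : Set Pt) :=
    EuclideanGeometry.collinear_of_angle_eq_zero h.symm
  have := (b i).ind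
  rw [affineIndependent_iff_not_collinear] at this
  apply this
  convert hc
  ext x
  simp only [Set.mem_range, Set.mem_insert_iff, Set.mem_singleton_iff, Fin.exists_fin_succ]
  fin_cases k <;> simp <;> tauto

/-- nonmiddle tiles at `P` -/
def nonmid (b : Fin N → Bas) (u P : Pt) : Finset (Fin N) :=
  Finset.univ.filter fun i => (∃ k, b i k = P) ∧ ¬ Dir (b i) P u ∧ ¬ Dir (b i) P (-u)

lemma Til.count_mid (H : Til b c) {P u : Pt} (hP : ∃ i k, b i k = P)
    (hu : ∀ i k, li (b i) k u ≠ 0) :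
    (tilesAt (fun i => ⇑(b i)) P).card + (Finset.univ.filter fun i => Flat (b i) P).card
      = (nonmid b u P).card + ((if Dir c P u then 1 else 0) + (if Dir c P (-u) then 1 else 0)) := by
  have hu' : ∀ i k, li (b i) k (-u) ≠ 0 := by
    intro i k; rw [map_neg]; exact neg_ne_zero.2 (hu i k)
  rw [← H.dir_count hu, ← H.dir_count hu', tilesAt, nonmid]
  simp only [Finset.card_filter, ← Finset.sum_add_distrib]
  refine Finset.sum_congr rfl fun i _ => ?_
  have hn := H.not_In_vertex hP i
  have hnb := not_both_dir (u := u) hn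
  by_cases hc : Cl (b i) P
  · rcases cl_cases hc with h | h | ⟨k, rfl⟩
    · exact absurd h hn
    · have h1 : ¬ ∃ k, b i k = P := by
        rintro ⟨k, rfl⟩
        exact vertex_not_Flat _ _ h
      rcases flat_dir h (hu i) with h2 | h2 <;> simp [h, h1, h2]
    · have h1 : ∃ l, b i l = b i k := ⟨k, rfl⟩
      have h2 := vertex_not_Flat (b i) k
      by_cases h3 : Dir (b i) (b i k) u <;> by_cases h4 : Dir (b i) (b i k) (-u)
      · exact absurd ⟨h3, h4⟩ hnb
      all_goals simp [h2, h3, h4]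
  · have h1 : ¬ ∃ k, b i k = P := by
      rintro ⟨k, rfl⟩
      exact hc (vertex_cl _ _)
    have h2 : ¬ Flat (b i) P := fun h => hc h.cl
    have h3 : ¬ Dir (b i) P u := fun h => hc h.cl
    have h4 : ¬ Dir (b i) P (-u) := fun h => hc h.cl
    simp [h1, h2, h3, h4]

lemma Til.nonmid_even (H : Til b c) {P u : Pt} (hP : ∃ i k, b i k = P)
    (hu : ∀ i k, li (b i) k u ≠ 0) (huc : ∀ k, li c k u ≠ 0)
    (hbdry : angleSumAt (fun i => ⇑(b i)) P = π → Odd (tilesAt (fun i => ⇑(b i)) P).card)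
    (hint : angleSumAt (fun i => ⇑(b i)) P = 2 * π → Even (tilesAt (fun i => ⇑(b i)) P).card)
    (hv : ∀ k, c k ≠ P) : Even (nonmid b u P).card := by
  have h1 := H.angle_total hP
  have h2 := H.angle_pos hP
  have h3 := H.count_mid hP hu
  rw [← Finset.sum_filter, Finset.sum_const, nsmul_eq_mul] at h1
  set f := (Finset.univ.filter fun i => Flat (b i) P).card
  have hc : Cl c P := by
    obtain ⟨i, k, rfl⟩ := hP
    exact (H.cover _).2 ⟨i, vertex_cl _ _⟩
  have hp := pi_pos
  rcases cl_cases hc with h | h | ⟨k, h⟩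
  · rw [ang_In h] at h1
    have hf : f < 2 := by
      have : (f:ℝ) < 2 := by
        by_contra hcon
        have : 2 * π ≤ f * π := mul_le_mul_of_nonneg_right (not_lt.1 hcon) hp.le
        linarith
      exact_mod_cast this
    rw [if_pos (h.dir _), if_pos (h.dir _)] at h3
    interval_cases f
    · have := hint (by norm_num at h1; linarith)
      rw [Nat.even_iff] at *
      omega
    · have := hbdry (by norm_num at h1; linarith)
      rw [Nat.even_iff]
      rw [Nat.odd_iff] at this
      omega
  · rw [ang_flat h] at h1
    have hf : f < 1 := by
      have : (f:ℝ) < 1 := by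
        by_contra hcon
        have : 1 * π ≤ f * π := mul_le_mul_of_nonneg_right (not_lt.1 hcon) hp.le
        linarith
      exact_mod_cast this
    have hf0 : f = 0 := by omega
    rw [hf0] at h1 h3
    have := hbdry (by norm_num at h1; linarith)
    rw [Nat.even_iff]
    rw [Nat.odd_iff] at this
    rcases flat_dir h huc with h4 | h4
    · rw [if_pos h4.1, if_neg h4.2] at h3
      omega
    · rw [if_neg h4.1, if_pos h4.2] at h3
      omega
  · exact absurd h (hv k)
end

lemma phi_repr (φ : Pt →ₗ[ℝ] ℝ) (b : Bas) (σ : Equiv.Perm (Fin 3)) (p : Pt) :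
    φ p = co b (σ 0) p * φ (b (σ 0)) + co b (σ 1) p * φ (b (σ 1)) + co b (σ 2) p * φ (b (σ 2)) := by
  have h := co_repr b 0 p
  conv_lhs => rw [h]
  simp only [map_add, map_smul, smul_eq_mul]
  have := Equiv.sum_comp σ (fun k => co b k p * φ (b k))
  rw [Fin.sum_univ_three, Fin.sum_univ_three] at this
  exact this.symm

lemma co_sum_perm (b : Bas) (σ : Equiv.Perm (Fin 3)) (p : Pt) :
    co b (σ 0) p + co b (σ 1) p + co b (σ 2) p = 1 := by
  have := Equiv.sum_comp σ (fun k => co b k p)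
  rw [Fin.sum_univ_three, Fin.sum_univ_three] at this
  rw [this, co_sum]

lemma phi_repr_li (φ : Pt →ₗ[ℝ] ℝ) (b : Bas) (σ : Equiv.Perm (Fin 3)) (p : Pt) :
    φ p = li b (σ 0) p * φ (b (σ 0)) + li b (σ 1) p * φ (b (σ 1)) + li b (σ 2) p * φ (b (σ 2)) := by
  have h1 := phi_repr φ b σ 0
  have h2 := phi_repr φ b σ (0 + p)
  simp only [co_add, map_add] at h2
  linarith

lemma li_sum_perm (b : Bas) (σ : Equiv.Perm (Fin 3)) (p : Pt) :
    li b (σ 0) p + li b (σ 1) p + li b (σ 2) p = 0 := by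
  have h1 := co_sum_perm b σ 0
  have h2 := co_sum_perm b σ (0 + p)
  simp only [co_add] at h2
  linarith

lemma forall_perm (σ : Equiv.Perm (Fin 3)) {p : Fin 3 → Prop} :
    (∀ k, p k) ↔ p (σ 0) ∧ p (σ 1) ∧ p (σ 2) := by
  rw [← σ.forall_congr_right, Fin.forall_fin_succ, Fin.forall_fin_two]
  rfl

/-- `σ` sorts the vertices by `φ`. -/
def Sorted (φ : Pt →ₗ[ℝ] ℝ) (b : Bas) (σ : Equiv.Perm (Fin 3)) : Prop :=
  φ (b (σ 0)) < φ (b (σ 1)) ∧ φ (b (σ 1)) < φ (b (σ 2))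

lemma exists_sorted (φ : Pt →ₗ[ℝ] ℝ) (b : Bas)
    (hinj : ∀ k l, φ (b k) = φ (b l) → k = l) : ∃ σ, Sorted φ b σ := by
  have hm := Tuple.monotone_sort (fun k => φ (b k))
  have hs : StrictMono ((fun k => φ (b k)) ∘ Tuple.sort (fun k => φ (b k))) := by
    refine hm.strictMono_of_injective ?_
    exact Function.Injective.comp (fun k l h => hinj k l h) (Equiv.injective _)
  exact ⟨Tuple.sort (fun k => φ (b k)), hs (by decide : (0 : Fin 3) < 1),
    hs (by decide : (1 : Fin 3) < 2)⟩

lemma Sorted.cl_le {φ : Pt →ₗ[ℝ] ℝ} {b : Bas} {σ : Equiv.Perm (Fin 3)} (h : Sorted φ b σ)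
    {p : Pt} (hp : Cl b p) : φ (b (σ 0)) ≤ φ p ∧ φ p ≤ φ (b (σ 2)) := by
  have h1 := phi_repr φ b σ p
  have h2 := co_sum_perm b σ p
  obtain ⟨s1, s2⟩ := h
  have h0 := hp (σ 0)
  have h01 := hp (σ 1)
  have h02 := hp (σ 2)
  have e1 : φ p - φ (b (σ 0)) = co b (σ 1) p * (φ (b (σ 1)) - φ (b (σ 0))) +
      co b (σ 2) p * (φ (b (σ 2)) - φ (b (σ 0))) := by linear_combination h1 + φ (b (σ 0)) * h2
  have e2 : φ (b (σ 2)) - φ p = co b (σ 0) p * (φ (b (σ 2)) - φ (b (σ 0))) +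
      co b (σ 1) p * (φ (b (σ 2)) - φ (b (σ 1))) := by linear_combination -h1 - φ (b (σ 2)) * h2
  constructor <;> linarith [mul_nonneg h01 (sub_pos.2 s1).le, mul_nonneg h02 (sub_pos.2 (s1.trans s2)).le,
    mul_nonneg h0 (sub_pos.2 (s1.trans s2)).le, mul_nonneg h01 (sub_pos.2 s2).le]

lemma Sorted.In_lt {φ : Pt →ₗ[ℝ] ℝ} {b : Bas} {σ : Equiv.Perm (Fin 3)} (h : Sorted φ b σ)
    {p : Pt} (hp : In b p) : φ (b (σ 0)) < φ p ∧ φ p < φ (b (σ 2)) := by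
  have h1 := phi_repr φ b σ p
  have h2 := co_sum_perm b σ p
  obtain ⟨s1, s2⟩ := h
  have h0 := hp (σ 0)
  have h01 := hp (σ 1)
  have h02 := hp (σ 2)
  have e1 : φ p - φ (b (σ 0)) = co b (σ 1) p * (φ (b (σ 1)) - φ (b (σ 0))) +
      co b (σ 2) p * (φ (b (σ 2)) - φ (b (σ 0))) := by linear_combination h1 + φ (b (σ 0)) * h2
  have e2 : φ (b (σ 2)) - φ p = co b (σ 0) p * (φ (b (σ 2)) - φ (b (σ 0))) +
      co b (σ 1) p * (φ (b (σ 2)) - φ (b (σ 1))) := by linear_combination -h1 - φ (b (σ 2)) * h2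
  constructor <;> linarith [mul_pos h01 (sub_pos.2 s1), mul_pos h02 (sub_pos.2 (s1.trans s2)),
    mul_pos h0 (sub_pos.2 (s1.trans s2)), mul_pos h01 (sub_pos.2 s2)]

lemma exists_In_near (φ : Pt →ₗ[ℝ] ℝ) {b : Bas} {p : Pt} (hp : Cl b p) (ε : ℝ) (hε : 0 < ε) :
    ∃ z, In b z ∧ |φ z - φ p| < ε := by
  obtain ⟨w, hw⟩ := exists_In b
  have h4 : ∀ᶠ t : ℝ in nhdsWithin 0 (Set.Ioi 0), t ∈ Set.Ioc (0:ℝ) 1 :=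
    Ioc_mem_nhdsGT one_pos
  have hc : Continuous fun t : ℝ => |t * φ (w - p)| := by fun_prop
  have h2 := hc.tendsto 0
  simp only [zero_mul, abs_zero] at h2
  have h3 := (h2.eventually (gt_mem_nhds hε)).filter_mono (nhdsWithin_le_nhds (s := Set.Ioi 0))
  obtain ⟨t, h5, h6⟩ := (h3.and h4).exists
  refine ⟨p + t • (w - p), In.comb hp hw h6.1 h6.2, ?_⟩
  rw [map_add, map_smul, add_sub_cancel_left]
  exact h5

lemma exists_In_phi (φ : Pt →ₗ[ℝ] ℝ) {b : Bas} {p q : Pt} (hp : Cl b p) (hq : Cl b q) {x : ℝ}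
    (h1 : φ p < x) (h2 : x < φ q) : ∃ z, In b z ∧ φ z = x := by
  obtain ⟨p', hp', h1'⟩ := exists_In_near φ hp (x - φ p) (by linarith)
  obtain ⟨q', hq', h2'⟩ := exists_In_near φ hq (φ q - x) (by linarith)
  rw [abs_lt] at h1' h2'
  have hlt : φ p' < x := by linarith
  have hlt2 : x < φ q' := by linarith
  refine ⟨p' + ((x - φ p') / (φ q' - φ p')) • (q' - p'), In.comb hp'.cl hq' ?_ ?_, ?_⟩
  · exact div_pos (by linarith) (by linarith)
  · rw [div_le_one (by linarith)]; linarith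
  · rw [map_add, map_smul, map_sub, smul_eq_mul, div_mul_cancel₀]
    · ring
    · linarith

def NM (b : Bas) (u P : Pt) : Prop := ¬ Dir b P u ∧ ¬ Dir b P (-u)

lemma Sorted.nm {φ : Pt →ₗ[ℝ] ℝ} {b : Bas} {σ : Equiv.Perm (Fin 3)} (h : Sorted φ b σ)
    {u : Pt} (hu : φ u = 0) (hne : ∀ k, li b k u ≠ 0) :
    NM b u (b (σ 0)) ∧ ¬ NM b u (b (σ 1)) ∧ NM b u (b (σ 2)) := by
  have h1 := phi_repr_li φ b σ u
  have h2 := li_sum_perm b σ u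
  rw [hu] at h1
  obtain ⟨s1, s2⟩ := h
  have n0 := hne (σ 0)
  have n1 := hne (σ 1)
  have n2 := hne (σ 2)
  have e01 : co b (σ 0) (b (σ 1)) = 0 := co_ne _ (by simp)
  have e02 : co b (σ 0) (b (σ 2)) = 0 := co_ne _ (by simp)
  have e10 : co b (σ 1) (b (σ 0)) = 0 := co_ne _ (by simp)
  have e12 : co b (σ 1) (b (σ 2)) = 0 := co_ne _ (by simp)
  have e20 : co b (σ 2) (b (σ 0)) = 0 := co_ne _ (by simp)
  have e21 : co b (σ 2) (b (σ 1)) = 0 := co_ne _ (by simp)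
  unfold NM Dir
  simp only [forall_perm σ, co_self, e01, e02, e10, e12, e20, e21, map_neg]
  simp only [zero_lt_one, true_or, lt_irrefl, false_or, true_and, and_true, Left.neg_pos_iff]
  generalize li b (σ 0) u = x0 at *
  generalize li b (σ 1) u = x1 at *
  generalize li b (σ 2) u = x2 at *
  generalize φ (b (σ 0)) = y0 at *
  generalize φ (b (σ 1)) = y1 at *
  generalize φ (b (σ 2)) = y2 at *
  have f0 : x1 * (y1 - y0) + x2 * (y2 - y0) = 0 := by linear_combination -h1 - y0 * h2
  have f1 : x2 * (y2 - y1) = x0 * (y1 - y0) := by linear_combination -h1 - y1 * h2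
  have f2 : x0 * (y2 - y0) + x1 * (y2 - y1) = 0 := by linear_combination h1 + y2 * h2
  refine ⟨⟨?_, ?_⟩, ?_, ?_, ?_⟩
  · rintro ⟨a, b⟩
    nlinarith [mul_pos a (sub_pos.2 s1), mul_pos b (sub_pos.2 (s1.trans s2))]
  · rintro ⟨a, b⟩
    nlinarith [mul_pos_of_neg_of_neg a (sub_neg.2 s1), mul_pos_of_neg_of_neg b (sub_neg.2 (s1.trans s2))]
  · rintro ⟨a, b⟩
    rcases n0.lt_or_gt with h | h
    · apply b
      refine ⟨h, ?_⟩
      by_contra hc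
      nlinarith [mul_pos_of_neg_of_neg h (sub_neg.2 s1), mul_nonneg (not_lt.1 hc) (sub_pos.2 s2).le]
    · apply a
      refine ⟨h, ?_⟩
      by_contra hc
      nlinarith [mul_pos h (sub_pos.2 s1), mul_nonneg (neg_nonneg.2 (not_lt.1 hc)) (sub_pos.2 s2).le]
  · rintro ⟨a, b⟩
    nlinarith [mul_pos a (sub_pos.2 (s1.trans s2)), mul_pos b (sub_pos.2 s2)]
  · rintro ⟨a, b⟩
    nlinarith [mul_pos_of_neg_of_neg a (sub_neg.2 (s1.trans s2)), mul_pos_of_neg_of_neg b (sub_neg.2 s2)]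

lemma Sorted.sum_nm {φ : Pt →ₗ[ℝ] ℝ} {b : Bas} {σ : Equiv.Perm (Fin 3)} (h : Sorted φ b σ)
    {u : Pt} (hu : φ u = 0) (hne : ∀ k, li b k u ≠ 0) (Q : Pt → Prop) :
    ∑ k, (if NM b u (b k) ∧ Q (b k) then (1 : ZMod 2) else 0) =
      (if Q (b (σ 0)) then 1 else 0) + (if Q (b (σ 2)) then 1 else 0) := by
  obtain ⟨h0, h1, h2⟩ := h.nm hu hne
  rw [← Equiv.sum_comp σ, Fin.sum_univ_three]
  simp [h0, h1, h2]

structure Gen {N : ℕ} (b : Fin N → Bas) (c : Bas) (u : Pt) (φ : Pt →ₗ[ℝ] ℝ) : Prop where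
  phi_u : φ u = 0
  ker : ∀ p q, φ p = φ q → ∃ t : ℝ, q = p + t • u
  inj : ∀ i k j l, φ (b i k) = φ (b j l) → b i k = b j l
  l0 : 0 < li c 0 u
  l1 : li c 1 u < 0
  l2 : li c 2 u < 0
  o1 : φ (c 1) < φ (c 0)
  o2 : φ (c 0) < φ (c 2)

def Ray (b : Bas) (u p : Pt) : Prop := ∃ t : ℝ, 0 < t ∧ In b (p + t • u)

section
variable {N : ℕ} {b : Fin N → Bas} {c : Bas} {u : Pt} {φ : Pt →ₗ[ℝ] ℝ}

def cnt (b : Fin N → Bas) (u p : Pt) : ZMod 2 := ∑ i, if Ray (b i) u p then 1 else 0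

lemma Gen.inj1 (G : Gen b c u φ) (i : Fin N) (k l : Fin 3) (h : φ (b i k) = φ (b i l)) : k = l :=
  (b i).ind.injective (G.inj _ _ _ _ h)

lemma Gen.li_ne (G : Gen b c u φ) (i : Fin N) (k : Fin 3) : li (b i) k u ≠ 0 := by
  intro h
  have h1 := li_repr (b i) k u
  have h2 := li_sum' (b i) k u
  have n3 : k + 1 ≠ k + 2 := by fin_cases k <;> simp
  rw [h] at h1 h2
  have h3 : li (b i) (k+1) u = - li (b i) (k+2) u := by linarith
  have h4 := congrArg φ h1
  rw [h3] at h4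
  simp only [map_add, map_smul, smul_eq_mul, G.phi_u] at h4
  have h5 : li (b i) (k+2) u * (φ (b i (k+2)) - φ (b i (k+1))) = 0 := by linarith
  rcases mul_eq_zero.1 h5 with h6 | h6
  · rw [h3, h6] at h1
    simp at h1
    have := G.l0
    rw [h1] at this
    simp at this
  · exact n3 (G.inj1 i _ _ (by linarith))

lemma Gen.sorted (G : Gen b c u φ) (i : Fin N) : ∃ σ, Sorted φ (b i) σ :=
  exists_sorted φ (b i) (G.inj1 i)

lemma Gen.u_ker (G : Gen b c u φ) (p : Pt) (t : ℝ) : φ (p + t • u) = φ p := by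
  rw [map_add, map_smul, G.phi_u]; simp

/-- Counting over tiles of nonmiddle vertices, organized by points. -/
lemma sum_by_points (b : Fin N → Bas) (u : Pt) (Q : Pt → Prop) :
    ∑ i, ∑ k, (if NM (b i) u (b i k) ∧ Q (b i k) then (1 : ZMod 2) else 0) =
    ∑ P ∈ Finset.univ.image (fun x : Fin N × Fin 3 => b x.1 x.2),
      if Q P then ((nonmid b u P).card : ZMod 2) else 0 := by
  have h1 : ∀ P, (if Q P then ((nonmid b u P).card : ZMod 2) else 0) =
      ∑ i, ∑ k, if b i k = P then (if NM (b i) u P ∧ Q P then (1 : ZMod 2) else 0) else 0 := by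
    intro P
    by_cases hQ : Q P
    swap
    · simp [hQ]
    rw [if_pos hQ, nonmid, Finset.card_filter]
    push_cast
    refine Finset.sum_congr rfl fun i _ => ?_
    by_cases hk : ∃ k, b i k = P
    · obtain ⟨k, rfl⟩ := hk
      rw [Finset.sum_eq_single k]
      · have : ∃ l, b i l = b i k := ⟨k, rfl⟩
        simp only [this, true_and, if_true, NM, hQ, and_true]
      · intro l _ hl
        rw [if_neg]
        exact fun h => hl ((b i).ind.injective h)
      · simp
    · rw [Finset.sum_eq_zero]
      · simp [hk]
      · intro k _
        rw [if_neg fun h => hk ⟨k, h⟩]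
  simp only [h1]
  rw [Finset.sum_comm (s := Finset.univ.image (fun x : Fin N × Fin 3 => b x.1 x.2))]
  refine Finset.sum_congr rfl fun i _ => ?_
  rw [Finset.sum_comm]
  refine Finset.sum_congr rfl fun k _ => ?_
  have hm : b i k ∈ Finset.univ.image (fun x : Fin N × Fin 3 => b x.1 x.2) :=
    Finset.mem_image.2 ⟨(i, k), Finset.mem_univ _, rfl⟩
  rw [Finset.sum_ite_eq, if_pos hm]

end

section
variable {N : ℕ} {b : Fin N → Bas} {c : Bas} {u : Pt} {φ : Pt →ₗ[ℝ] ℝ}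

/-- height of `z` above the line `p q`. -/
def ht (c : Bas) (φ : Pt →ₗ[ℝ] ℝ) (p q z : Pt) : ℝ :=
  li c 0 (z - p) - ((φ z - φ p) / (φ q - φ p)) * li c 0 (q - p)

def Win (c : Bas) (φ : Pt →ₗ[ℝ] ℝ) (p q z : Pt) : Prop :=
  φ p < φ z ∧ φ z < φ q ∧ 0 < ht c φ p q z

lemma ht_comb (c : Bas) (φ : Pt →ₗ[ℝ] ℝ) (p q z w : Pt) (t : ℝ) :
    ht c φ p q (z + t • (w - z)) = (1 - t) * ht c φ p q z + t * ht c φ p q w := by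
  unfold ht
  simp only [map_sub, map_add, map_smul, smul_eq_mul]
  ring

lemma ht_zero (G : Gen b c u φ) {p q z : Pt} (hpq : φ p < φ q) (h : ht c φ p q z = 0) :
    z = p + ((φ z - φ p) / (φ q - φ p)) • (q - p) := by
  have hphi : φ (p + ((φ z - φ p) / (φ q - φ p)) • (q - p)) = φ z := by
    rw [map_add, map_smul, map_sub, smul_eq_mul, div_mul_cancel₀]
    · ring
    · linarith
  obtain ⟨t, ht'⟩ := G.ker _ _ hphi
  unfold ht at h
  set s := (φ z - φ p) / (φ q - φ p)
  have h2 : li c 0 (z - p) = s * li c 0 (q - p) + t * li c 0 u := by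
    rw [ht']
    simp only [map_sub, map_add, map_smul, smul_eq_mul]
    ring
  have h3 : t * li c 0 u = 0 := by linarith
  have : t = 0 := (mul_eq_zero.1 h3).resolve_right G.l0.ne'
  rw [this] at ht'
  conv_lhs => rw [ht']
  simp

lemma ht_ray (G : Gen b c u φ) {p q z : Pt} (t : ℝ) :
    ht c φ p q (z + t • u) = ht c φ p q z + t * li c 0 u := by
  unfold ht
  simp only [map_sub, map_add, map_smul, smul_eq_mul, G.phi_u]
  ring

lemma ht_left (p q : Pt) : ht c φ p q p = 0 := by simp [ht]
lemma ht_right {p q : Pt} (h : φ p < φ q) : ht c φ p q q = 0 := by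
  unfold ht
  rw [div_self (by linarith)]; ring

lemma ht_sign (H : Til b c) (G : Gen b c u φ) {i l : Fin N} (hil : i ≠ l) {p q : Pt}
    (hp : In (b i) p) (hq : In (b i) q) (hpq : φ p < φ q) {z w : Pt}
    (hz : Cl (b l) z) (hw : Cl (b l) w) (hz1 : φ p ≤ φ z) (hz2 : φ z ≤ φ q)
    (hw1 : φ p ≤ φ w) (hw2 : φ w ≤ φ q) (h : 0 < ht c φ p q z) : 0 < ht c φ p q w := by
  by_contra hc
  push Not at hc
  set A := ht c φ p q z
  set B := ht c φ p q w
  have hAB : 0 < A - B := by linarith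
  set t := A / (A - B) with ht'
  have t0 : 0 ≤ t := div_nonneg h.le hAB.le
  have t1 : t ≤ 1 := by rw [ht', div_le_one hAB]; linarith
  have hv : ht c φ p q (z + t • (w - z)) = 0 := by
    rw [ht_comb]
    change (1 - t) * A + t * B = 0
    have : t * (A - B) = A := div_mul_cancel₀ _ hAB.ne'
    linarith
  have hcl := Cl.comb hz hw t0 t1
  have hphi : φ (z + t • (w - z)) = (1 - t) * φ z + t * φ w := by
    simp only [map_sub, map_add, map_smul, smul_eq_mul]; ring
  have hz' := ht_zero G hpq hv
  set v := z + t • (w - z)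
  have r1 : φ p ≤ φ v := by
    rw [hphi]
    have := mul_nonneg (sub_nonneg.2 t1) (sub_nonneg.2 hz1)
    have := mul_nonneg t0 (sub_nonneg.2 hw1)
    linarith
  have r2 : φ v ≤ φ q := by
    rw [hphi]
    have := mul_nonneg (sub_nonneg.2 t1) (sub_nonneg.2 hz2)
    have := mul_nonneg t0 (sub_nonneg.2 hw2)
    linarith
  have hIn : In (b i) v := by
    rcases r1.lt_or_eq with r1 | r1
    · rw [hz']
      refine In.comb hp.cl hq (div_pos (by linarith) (by linarith)) ?_
      rw [div_le_one (by linarith)]; linarith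
    · rw [hz', ← r1]
      simpa using hp
  exact hil (H.disj' hIn hcl)

lemma step (H : Til b c) (G : Gen b c u φ) {i l : Fin N} (hil : i ≠ l) {p q : Pt}
    (hp : In (b i) p) (hq : In (b i) q) (hpq : φ p < φ q)
    (gp : ∀ i k, φ p ≠ φ (b i k)) (gq : ∀ i k, φ q ≠ φ (b i k)) :
    (if Ray (b l) u p then (1 : ZMod 2) else 0) + (if Ray (b l) u q then 1 else 0) =
    ∑ k, if NM (b l) u (b l k) ∧ Win c φ p q (b l k)
      then 1 else 0 := by
  obtain ⟨σ, hσ⟩ := G.sorted l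
  rw [hσ.sum_nm G.phi_u (G.li_ne l)
    (Win c φ p q)]
  set S : Prop := ∃ z, Cl (b l) z ∧ φ p ≤ φ z ∧ φ z ≤ φ q ∧ 0 < ht c φ p q z with hS
  have key : ∀ {x}, φ p ≤ φ x → φ x ≤ φ q → ht c φ p q x = 0 →
      (Ray (b l) u x ↔ S ∧ φ (b l (σ 0)) < φ x ∧ φ x < φ (b l (σ 2))) := by
    intro x x1 x2 x3
    constructor
    · rintro ⟨t, t0, hI⟩
      have h2 := hσ.In_lt hI
      rw [G.u_ker] at h2
      refine ⟨⟨x + t • u, hI.cl, ?_, ?_, ?_⟩, h2⟩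
      · rwa [G.u_ker]
      · rwa [G.u_ker]
      · rw [ht_ray G, x3, zero_add]
        exact mul_pos t0 G.l0
    · rintro ⟨⟨z, z1, z2, z3, z4⟩, h1, h2⟩
      obtain ⟨w, hw, hw2⟩ := exists_In_phi φ (vertex_cl (b l) (σ 0)) (vertex_cl (b l) (σ 2)) h1 h2
      have h5 := ht_sign H G hil hp hq hpq z1 hw.cl z2 z3 (by linarith) (by linarith) z4
      obtain ⟨t, ht'⟩ := G.ker x w hw2.symm
      refine ⟨t, ?_, ht' ▸ hw⟩
      rw [ht', ht_ray G, x3, zero_add] at h5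
      exact (pos_iff_pos_of_mul_pos h5).2 G.l0
  have key2 : ∀ k, Win c φ p q (b l k) ↔
      S ∧ φ p < φ (b l k) ∧ φ (b l k) < φ q := by
    intro k
    constructor
    · rintro ⟨h1, h2, h3⟩
      exact ⟨⟨_, vertex_cl _ k, h1.le, h2.le, h3⟩, h1, h2⟩
    · rintro ⟨⟨z, z1, z2, z3, z4⟩, h1, h2⟩
      exact ⟨h1, h2, ht_sign H G hil hp hq hpq z1 (vertex_cl _ k) z2 z3 h1.le h2.le z4⟩
  rw [if_congr (key le_rfl hpq.le (ht_left p q)) rfl rfl,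
    if_congr (key hpq.le le_rfl (ht_right hpq)) rfl rfl,
    if_congr (key2 (σ 0)) rfl rfl, if_congr (key2 (σ 2)) rfl rfl]
  by_cases hs : S
  swap
  · simp [hs]
  simp only [hs, true_and]
  have g1 := gp l (σ 0)
  have g2 := gp l (σ 2)
  have g3 := gq l (σ 0)
  have g4 := gq l (σ 2)
  have o := hσ.1.trans hσ.2
  generalize φ (b l (σ 0)) = y0 at *
  generalize φ (b l (σ 2)) = y2 at *
  generalize φ p = x at *
  generalize φ q = y at *
  have two : (1 : ZMod 2) + 1 = 0 := by decide
  rcases g1.lt_or_gt with g1 | g1 <;> rcases g2.lt_or_gt with g2 | g2 <;>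
  rcases g3.lt_or_gt with g3 | g3 <;> rcases g4.lt_or_gt with g4 | g4 <;>
  first
  | (exfalso; linarith)
  | simp [g1, g2, g3, g4, not_lt.2 g1.le, not_lt.2 g2.le, not_lt.2 g3.le, not_lt.2 g4.le, two]

lemma ray_same (H : Til b c) {i l : Fin N} (hil : i ≠ l) {p q : Pt} {τ : ℝ} (hτ : 0 < τ)
    (hq : q = p + τ • u) (hseg : ∀ t, 0 < t → t < τ → In (b i) (p + t • u)) :
    Ray (b l) u p ↔ Ray (b l) u q := by
  constructor
  · rintro ⟨t, t0, hI⟩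
    rcases lt_trichotomy t τ with h | h | h
    · exact absurd (H.disj _ _ _ (hseg t t0 h) hI) hil
    · exfalso
      have h1 := (hI.eventually (-u)).filter_mono (nhdsWithin_le_nhds (s := Set.Ioi 0))
      have h4 : ∀ᶠ s : ℝ in nhdsWithin 0 (Set.Ioi 0), s ∈ Set.Ioo (0:ℝ) τ := Ioo_mem_nhdsGT hτ
      obtain ⟨s, h5, h6⟩ := (h1.and h4).exists
      have h7 := hseg (τ - s) (by linarith [h6.2]) (by linarith [h6.1])
      refine hil (H.disj _ _ _ h7 ?_)
      convert h5 using 1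
      rw [h]
      module
    · refine ⟨t - τ, by linarith, ?_⟩
      convert hI using 1
      rw [hq]
      module
  · rintro ⟨t, t0, hI⟩
    refine ⟨t + τ, by linarith, ?_⟩
    convert hI using 1
    rw [hq]
    module

lemma ray_self {i : Fin N} {p : Pt} (h : Dir (b i) p u) : Ray (b i) u p := by
  have h4 : ∀ᶠ s : ℝ in nhdsWithin 0 (Set.Ioi 0), s ∈ Set.Ioo (0:ℝ) 1 := Ioo_mem_nhdsGT one_pos
  obtain ⟨s, h5, h6⟩ := (h.eventually.and h4).exists
  exact ⟨s, h6.1, h5⟩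

/-- the parity hypothesis -/
def EvenAt (b : Fin N → Bas) (c : Bas) (u : Pt) : Prop :=
  ∀ P, (∃ i k, b i k = P) → P ≠ c 1 → P ≠ c 2 → Even (nonmid b u P).card

lemma Gen.csorted (G : Gen b c u φ) : Sorted φ c (Equiv.swap 0 1) := by
  have e2 : (Equiv.swap (0 : Fin 3) 1) 2 = 2 := by decide
  refine ⟨?_, ?_⟩
  · simpa using G.o1
  · rw [e2]; simpa using G.o2

lemma Gen.c_In (G : Gen b c u φ) {p : Pt} (h : In c p) : φ (c 1) < φ p ∧ φ p < φ (c 2) := by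
  have e2 : (Equiv.swap (0 : Fin 3) 1) 2 = 2 := by decide
  have := G.csorted.In_lt h
  rw [e2] at this
  simpa using this

lemma Gen.c_Cl (G : Gen b c u φ) {p : Pt} (h : Cl c p) : φ (c 1) ≤ φ p ∧ φ p ≤ φ (c 2) := by
  have e2 : (Equiv.swap (0 : Fin 3) 1) 2 = 2 := by decide
  have := G.csorted.cl_le h
  rw [e2] at this
  simpa using this

lemma zmod_add_eq {x y : ZMod 2} (h : x + y = 0) : x = y := by
  revert x y; decide

lemma cnt_const_lt (H : Til b c) (G : Gen b c u φ) (E : EvenAt b c u) {i : Fin N} {p q : Pt}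
    (hp : In (b i) p) (hq : In (b i) q) (hpq : φ p < φ q)
    (gp : ∀ i k, φ p ≠ φ (b i k)) (gq : ∀ i k, φ q ≠ φ (b i k)) :
    cnt b u p = cnt b u q := by
  apply zmod_add_eq
  unfold cnt
  rw [← Finset.sum_add_distrib]
  have h1 : ∀ l, (if Ray (b l) u p then (1 : ZMod 2) else 0) + (if Ray (b l) u q then 1 else 0) =
    ∑ k, if NM (b l) u (b l k) ∧ Win c φ p q (b l k)
      then 1 else 0 := by
    intro l
    by_cases hil : i = l
    · subst hil
      rw [if_pos (ray_self (hp.dir u)), if_pos (ray_self (hq.dir u))]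
      obtain ⟨σ, hσ⟩ := G.sorted i
      rw [hσ.sum_nm G.phi_u (G.li_ne i)
        (Win c φ p q)]
      have o1 := hσ.In_lt hp
      have o2 := hσ.In_lt hq
      rw [if_neg (fun h => by linarith [h.1]), if_neg (fun h => by linarith [h.2.1])]
      decide
    · exact step H G hil hp hq hpq gp gq
  rw [Finset.sum_congr rfl fun l _ => h1 l,
    sum_by_points b u (Win c φ p q)]
  refine Finset.sum_eq_zero fun P hP => ?_
  split_ifs with hQ
  · obtain ⟨x, -, hx⟩ := Finset.mem_image.1 hP
    have o1 := G.c_In (H.sub i _ hp)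
    have o2 := G.c_In (H.sub i _ hq)
    have := E P ⟨x.1, x.2, hx⟩ (by rintro rfl; linarith [hQ.1]) (by rintro rfl; linarith [hQ.2.1])
    exact (ZMod.natCast_eq_zero_iff_even).2 this
  · rfl

lemma cnt_const (H : Til b c) (G : Gen b c u φ) (E : EvenAt b c u) {i : Fin N} {p q : Pt}
    (hp : In (b i) p) (hq : In (b i) q)
    (gp : ∀ i k, φ p ≠ φ (b i k)) (gq : ∀ i k, φ q ≠ φ (b i k)) :
    cnt b u p = cnt b u q := by
  rcases lt_trichotomy (φ p) (φ q) with h | h | h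
  · exact cnt_const_lt H G E hp hq h gp gq
  · have main : ∀ {p q : Pt} {t : ℝ}, In (b i) p → In (b i) q → 0 < t → q = p + t • u →
        cnt b u p = cnt b u q := by
      intro p q t hp hq ht hqq
      unfold cnt
      refine Finset.sum_congr rfl fun l _ => if_congr ?_ rfl rfl
      by_cases hil : i = l
      · subst hil
        exact iff_of_true (ray_self (hp.dir u)) (ray_self (hq.dir u))
      · refine ray_same H hil ht hqq fun s s0 s1 => ?_
        have := In.comb hp.cl hq (div_pos s0 ht) ((div_le_one ht).2 s1.le)
        convert this using 2
        rw [hqq, add_sub_cancel_left, smul_smul, div_mul_cancel₀ _ ht.ne']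
    obtain ⟨t, ht⟩ := G.ker _ _ h
    rcases lt_trichotomy t 0 with h0 | h0 | h0
    · refine (main hq hp (neg_pos.2 h0) ?_).symm
      rw [ht]; module
    · rw [ht, h0]; simp
    · exact main hp hq h0 ht
  · exact (cnt_const_lt H G E hq hp h gq gp).symm

end

section
variable {N : ℕ} {b : Fin N → Bas} {c : Bas} {u : Pt} {φ : Pt →ₗ[ℝ] ℝ}

/-- generic points -/
def GenPt (b : Fin N → Bas) (φ : Pt →ₗ[ℝ] ℝ) (q : Pt) : Prop := ∀ i k, φ q ≠ φ (b i k)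

/-- `κ` is the color number -/
def IsCol (b : Fin N → Bas) (u : Pt) (φ : Pt →ₗ[ℝ] ℝ) (κ : Fin N → ZMod 2) : Prop :=
  ∀ i p, In (b i) p → GenPt b φ p → cnt b u p = κ i

lemma exists_col (H : Til b c) (G : Gen b c u φ) (E : EvenAt b c u) : ∃ κ, IsCol b u φ κ := by
  have : ∀ i, ∃ x : ZMod 2, ∀ p, In (b i) p → GenPt b φ p → cnt b u p = x := by
    intro i
    by_cases h : ∃ p, In (b i) p ∧ GenPt b φ p
    · obtain ⟨p, h1, h2⟩ := h
      exact ⟨cnt b u p, fun q h3 h4 => cnt_const H G E h3 h1 h4 h2⟩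
    · exact ⟨0, fun p h1 h2 => absurd ⟨p, h1, h2⟩ h⟩
  choose κ hκ using this
  exact ⟨κ, hκ⟩

lemma GenPt.shift (G : Gen b c u φ) {q : Pt} (h : GenPt b φ q) (t : ℝ) : GenPt b φ (q + t • u) := by
  intro i k
  rw [G.u_ker]
  exact h i k

lemma col_up (H : Til b c) (G : Gen b c u φ) {κ : Fin N → ZMod 2} (K : IsCol b u φ κ)
    {q : Pt} (g : GenPt b φ q) {j : Fin N} (hj : Dir (b j) q u) : κ j = cnt b u q := by
  have h4 : ∀ᶠ s : ℝ in nhdsWithin 0 (Set.Ioi 0), s ∈ Set.Ioo (0:ℝ) 1 := Ioo_mem_nhdsGT one_pos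
  obtain ⟨s, h5, h6⟩ := (hj.eventually.and h4).exists
  rw [← K j _ h5 (g.shift G s)]
  unfold cnt
  refine Finset.sum_congr rfl fun l _ => if_congr ?_ rfl rfl
  by_cases hil : j = l
  · subst hil
    exact iff_of_true (ray_self (h5.dir u)) (ray_self hj)
  · symm
    refine ray_same H hil h6.1 rfl fun t t0 t1 => ?_
    have := In.comb hj.cl h5 (div_pos t0 h6.1) ((div_le_one h6.1).2 t1.le)
    convert this using 2
    rw [add_sub_cancel_left, smul_smul, div_mul_cancel₀ _ h6.1.ne']

lemma col_low (H : Til b c) (G : Gen b c u φ) {κ : Fin N → ZMod 2} (K : IsCol b u φ κ)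
    {q : Pt} (g : GenPt b φ q) {i : Fin N} (hi : Dir (b i) q (-u)) (hI : ¬ In (b i) q) :
    κ i = cnt b u q + 1 := by
  have h4 : ∀ᶠ s : ℝ in nhdsWithin 0 (Set.Ioi 0), s ∈ Set.Ioo (0:ℝ) 1 := Ioo_mem_nhdsGT one_pos
  obtain ⟨s, h5, h6⟩ := (hi.eventually.and h4).exists
  have e : q + s • (-u) = q + (-s) • u := by module
  rw [e] at h5
  rw [← K i _ h5 (g.shift G _)]
  unfold cnt
  have h7 : ∀ l, (if Ray (b l) u (q + (-s) • u) then (1 : ZMod 2) else 0) =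
      (if Ray (b l) u q then 1 else 0) + if l = i then 1 else 0 := by
    intro l
    by_cases hil : l = i
    · subst hil
      rw [if_pos (ray_self (h5.dir u)), if_pos rfl, if_neg, zero_add]
      rintro ⟨t, t0, h8⟩
      apply hI
      have h9 : 0 < s + t := by linarith [h6.1]
      have := In.comb h5.cl h8 (t := s / (s + t)) (div_pos h6.1 h9)
        ((div_le_one h9).2 (by linarith))
      convert this using 1
      have e2 : q + t • u - (q + (-s) • u) = (s + t) • u := by module
      rw [e2, smul_smul, div_mul_cancel₀ _ h9.ne']
      module
    · rw [if_neg hil, add_zero]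
      refine if_congr ?_ rfl rfl
      refine ray_same H (Ne.symm hil) h6.1 (by module) fun t t0 t1 => ?_
      have := In.comb hi.cl h5 (t := (s - t) / s) (div_pos (by linarith) h6.1)
        ((div_le_one h6.1).2 (by linarith))
      convert this using 1
      have e2 : q + (-s) • u - q = s • (-u) := by module
      rw [e2, smul_smul, div_mul_cancel₀ _ h6.1.ne']
      module
  rw [Finset.sum_congr rfl fun l _ => h7 l, Finset.sum_add_distrib]
  simp

lemma cnt_top (H : Til b c) {q : Pt} (hq : Cl c q) (hd : ¬ Dir c q u) : cnt b u q = 0 := by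
  unfold cnt
  refine Finset.sum_eq_zero fun l _ => if_neg ?_
  rintro ⟨t, t0, h⟩
  exact hd (dir_of_In hq t0 (H.sub _ _ h))

lemma col_top (H : Til b c) (G : Gen b c u φ) {κ : Fin N → ZMod 2} (K : IsCol b u φ κ)
    {q : Pt} (g : GenPt b φ q) {i : Fin N} (hi : Dir (b i) q (-u)) (hd : ¬ Dir c q u) :
    κ i = 1 := by
  rw [col_low H G K g hi, cnt_top H ((H.cover q).2 ⟨i, hi.cl⟩) hd, zero_add]
  exact fun h => hd ((H.sub _ _ h).dir u)

lemma co_expand (b c : Bas) (m : Fin 3) (p : Pt) :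
    co c m p = co b 0 p * co c m (b 0) + co b 1 p * co c m (b 1) + co b 2 p * co c m (b 2) := by
  have h1 := phi_repr (li c m) b 1 p
  have h2 := co_sum b p
  have h3 : ∀ x, co c m x = co c m 0 + li c m x := fun x => by rw [← co_add, zero_add]
  simp only [Equiv.Perm.coe_one, id] at h1
  rw [h3 p, h3 (b 0), h3 (b 1), h3 (b 2)]
  linear_combination h1 - co c m 0 * h2

lemma co_le_one {b : Bas} {p : Pt} (h : Cl b p) (k : Fin 3) : co b k p ≤ 1 := by
  have := co_sum' b k p
  linarith [h (k+1), h (k+2)]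

lemma eq_vertex {b : Bas} {p : Pt} (h : Cl b p) {k : Fin 3} (hk : co b k p = 1) : p = b k := by
  have h1 := co_sum' b k p
  have h2 := h (k+1)
  have h3 := h (k+2)
  apply co_ext b
  refine (forall_cyc k).2 ⟨?_, ?_, ?_⟩
  · rw [co_self, hk]
  · rw [co_ne _ (by fin_cases k <;> simp)]; linarith
  · rw [co_ne _ (by fin_cases k <;> simp)]; linarith

lemma Til.extreme (H : Til b c) {j : Fin N} {m : Fin 3} (h : Cl (b j) (c m)) :
    ∃ k, b j k = c m := by
  by_contra hne
  push Not at hne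
  have h1 := co_expand (b j) c m (c m)
  rw [co_self] at h1
  have h2 := co_sum (b j) (c m)
  have h3 : ∀ k, co c m (b j k) < 1 := by
    intro k
    have hc : Cl c (b j k) := (H.cover _).2 ⟨j, vertex_cl _ _⟩
    exact lt_of_le_of_ne (co_le_one hc m) fun h => hne k (eq_vertex hc h)
  have e : co (b j) 0 (c m) * (1 - co c m (b j 0)) + co (b j) 1 (c m) * (1 - co c m (b j 1)) +
    co (b j) 2 (c m) * (1 - co c m (b j 2)) = 0 := by linear_combination h2 + h1
  have f : ∀ k, 0 ≤ co (b j) k (c m) * (1 - co c m (b j k)) := fun k =>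
    mul_nonneg (h k) (by linarith [h3 k])
  have z : ∀ k, co (b j) k (c m) * (1 - co c m (b j k)) = 0 → co (b j) k (c m) = 0 := by
    intro k hk
    refine (mul_eq_zero.1 hk).resolve_right ?_
    linarith [h3 k]
  have := z 0 (by linarith [f 0, f 1, f 2])
  have := z 1 (by linarith [f 0, f 1, f 2])
  have := z 2 (by linarith [f 0, f 1, f 2])
  linarith

lemma Til.c_vertex (H : Til b c) (m : Fin 3) : ∃ i k, b i k = c m := by
  obtain ⟨j, hj⟩ := (H.cover (c m)).1 (vertex_cl c m)
  exact ⟨j, H.extreme hj⟩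

def Below (φ : Pt →ₗ[ℝ] ℝ) (q z : Pt) : Prop := φ z < φ q

lemma nonmid_c1 (H : Til b c) (G : Gen b c u φ) :
    nonmid b u (c 1) = tilesAt (fun i => ⇑(b i)) (c 1) := by
  unfold nonmid tilesAt
  ext i
  simp only [Finset.mem_filter, Finset.mem_univ, true_and, and_iff_left_iff_imp]
  rintro ⟨k, hk⟩
  constructor
  · intro h
    obtain ⟨t, ht⟩ := h.eventually.exists
    have := (G.c_In (H.sub _ _ ht)).1
    rw [G.u_ker] at this
    exact lt_irrefl _ this
  · intro h
    obtain ⟨t, ht⟩ := h.eventually.exists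
    have := (G.c_In (H.sub _ _ ht)).1
    rw [show c 1 + t • -u = c 1 + (-t) • u by module, G.u_ker] at this
    exact lt_irrefl _ this

lemma cnt_bot (H : Til b c) (G : Gen b c u φ) (E : EvenAt b c u) {q : Pt} (g : GenPt b φ q)
    (hq : Cl c q) (h0 : co c 0 q = 0) :
    cnt b u q = ((tilesAt (fun i => ⇑(b i)) (c 1)).card : ZMod 2) := by
  have h1 : ∀ l, (if Ray (b l) u q then (1 : ZMod 2) else 0) =
      ∑ k, if NM (b l) u (b l k) ∧ Below φ q (b l k) then 1 else 0 := by
    intro l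
    obtain ⟨σ, hσ⟩ := G.sorted l
    rw [hσ.sum_nm G.phi_u (G.li_ne l)]
    have key : Ray (b l) u q ↔ φ (b l (σ 0)) < φ q ∧ φ q < φ (b l (σ 2)) := by
      constructor
      · rintro ⟨t, t0, hI⟩
        have h2 := hσ.In_lt hI
        rwa [G.u_ker] at h2
      · rintro ⟨h1, h2⟩
        obtain ⟨w, hw, hw2⟩ := exists_In_phi φ (vertex_cl (b l) (σ 0)) (vertex_cl (b l) (σ 2)) h1 h2
        obtain ⟨t, ht'⟩ := G.ker q w hw2.symm
        refine ⟨t, ?_, ht' ▸ hw⟩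
        have h5 := H.sub _ _ hw 0
        rw [ht', co_line, h0, zero_add] at h5
        exact (pos_iff_pos_of_mul_pos h5).2 G.l0
    rw [if_congr key rfl rfl]
    unfold Below
    have o := hσ.1.trans hσ.2
    have g1 := g l (σ 0)
    have g2 := g l (σ 2)
    generalize φ (b l (σ 0)) = y0 at *
    generalize φ (b l (σ 2)) = y2 at *
    generalize φ q = x at *
    have two : (1 : ZMod 2) + 1 = 0 := by decide
    rcases g1.lt_or_gt with g1 | g1 <;> rcases g2.lt_or_gt with g2 | g2 <;>
    first
    | (exfalso; linarith)
    | simp [g1, g2, not_lt.2 g1.le, not_lt.2 g2.le, two]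
  unfold cnt
  rw [Finset.sum_congr rfl fun l _ => h1 l, sum_by_points b u (Below φ q)]
  obtain ⟨i, k, hik⟩ := H.c_vertex 1
  rw [Finset.sum_eq_single (c 1)]
  · rw [if_pos, nonmid_c1 H G]
    have := (G.c_Cl hq).1
    refine lt_of_le_of_ne this ?_
    rw [← hik]
    exact (g i k).symm
  · intro P hP hne
    split_ifs with hQ
    · obtain ⟨x, -, hx⟩ := Finset.mem_image.1 hP
      refine (ZMod.natCast_eq_zero_iff_even).2 (E P ⟨x.1, x.2, hx⟩ hne ?_)
      rintro rfl
      have := (G.c_Cl hq).2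
      unfold Below at hQ
      linarith
    · rfl
  · intro hn
    exact absurd (Finset.mem_image.2 ⟨(i, k), Finset.mem_univ _, hik⟩) hn

end

section
variable {N : ℕ} {b : Fin N → Bas} {c : Bas} {u : Pt} {φ : Pt →ₗ[ℝ] ℝ}

lemma nongen_finite (b : Fin N → Bas) (φ : Pt →ₗ[ℝ] ℝ) (P d : Pt) (hd : φ d ≠ 0) :
    {t : ℝ | ¬ GenPt b φ (P + t • d)}.Finite := by
  have : {t : ℝ | ¬ GenPt b φ (P + t • d)} ⊆ ⋃ i, ⋃ k, {t : ℝ | φ (P + t • d) = φ (b i k)} := by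
    intro t ht
    change ¬ GenPt b φ (P + t • d) at ht
    unfold GenPt at ht
    push Not at ht
    obtain ⟨i, k, h⟩ := ht
    exact Set.mem_iUnion.2 ⟨i, Set.mem_iUnion.2 ⟨k, h⟩⟩
  refine Set.Finite.subset (Set.finite_iUnion fun i => Set.finite_iUnion fun k => ?_) this
  apply Set.Subsingleton.finite
  intro s hs t ht
  change φ (P + s • d) = φ (b i k) at hs
  change φ (P + t • d) = φ (b i k) at ht
  simp only [map_add, map_smul, smul_eq_mul] at hs ht
  have : (s - t) * φ d = 0 := by linarith
  rcases mul_eq_zero.1 this with h | h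
  · linarith
  · exact absurd h hd

lemma exists_gen (b : Fin N → Bas) (φ : Pt →ₗ[ℝ] ℝ) (P d : Pt) (hd : φ d ≠ 0) {ε : ℝ}
    (hε : 0 < ε) : ∃ t, 0 < t ∧ t < ε ∧ GenPt b φ (P + t • d) := by
  obtain ⟨t, h1, h2⟩ := ((Set.Ioo_infinite hε).sdiff (nongen_finite b φ P d hd)).nonempty
  exact ⟨t, h1.1, h1.2, not_not.1 h2⟩

lemma GenPt.cases {q : Pt} (g : GenPt b φ q) {i : Fin N} (h : Cl (b i) q) :
    In (b i) q ∨ Flat (b i) q := by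
  rcases cl_cases h with h | h | ⟨k, h⟩
  · exact Or.inl h
  · exact Or.inr h
  · exact absurd (by rw [h]) (g i k)

lemma col_cross (H : Til b c) (G : Gen b c u φ) {κ : Fin N → ZMod 2} (K : IsCol b u φ κ)
    {q : Pt} (g : GenPt b φ q) {i j : Fin N} (hij : i ≠ j) (hi : Dir (b i) q u)
    (hj : Dir (b j) q (-u)) : κ i ≠ κ j := by
  rw [col_up H G K g hi, col_low H G K g hj]
  · generalize cnt b u q = x
    revert x; decide
  · intro h
    exact hij (H.disj' h hi.cl).symm

lemma col_cross' (H : Til b c) (G : Gen b c u φ) {κ : Fin N → ZMod 2} (K : IsCol b u φ κ)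
    {q : Pt} (g : GenPt b φ q) {i j : Fin N} (hij : i ≠ j) (hi : Cl (b i) q)
    (hj : Cl (b j) q) : κ i ≠ κ j := by
  have fi := (g.cases hi).resolve_left fun h => hij (H.disj' h hj)
  have fj := (g.cases hj).resolve_left fun h => hij (H.disj' h hi).symm
  rcases flat_dir fi (G.li_ne i) with hi | hi <;> rcases flat_dir fj (G.li_ne j) with hj | hj
  · exact absurd (H.dir_unique hi.1 hj.1) hij
  · exact col_cross H G K g hij hi.1 hj.2
  · exact (col_cross H G K g hij.symm hj.1 hi.2).symm
  · exact absurd (H.dir_unique hi.2 hj.2) hij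

lemma triSet_eq (b : Bas) : triSet b = {p | Cl b p} := by
  unfold triSet
  rw [AffineBasis.convexHull_eq_nonneg_coord]
  rfl

lemma triSet_interior (b : Bas) : interior (triSet b) = {p | In b p} := by
  unfold triSet
  rw [AffineBasis.interior_convexHull]
  rfl

lemma triSet_frontier {b : Bas} {p : Pt} (h : p ∈ frontier (triSet b)) : Cl b p ∧ ¬ In b p := by
  have hc : IsClosed (triSet b) :=
    ((Set.finite_range b).isCompact_convexHull (𝕜 := ℝ)).isClosed
  rw [hc.frontier_eq, triSet_interior, triSet_eq] at h
  exact h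

lemma col_shares (H : Til b c) (G : Gen b c u φ) {κ : Fin N → ZMod 2} (K : IsCol b u φ κ)
    {i j : Fin N} (hij : i ≠ j) (hs : SharesEdgeSegment (fun i => ⇑(b i)) i j) : κ i ≠ κ j := by
  obtain ⟨P, Q, hPQ, hsub⟩ := hs
  have hseg : ∀ t : ℝ, 0 ≤ t → t ≤ 1 → P + t • (Q - P) ∈ segment ℝ P Q := by
    intro t t0 t1
    rw [segment_eq_image']
    exact ⟨t, ⟨t0, t1⟩, rfl⟩
  have h0 := triSet_frontier (hsub (hseg 0 le_rfl zero_le_one)).1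
  have h1 := triSet_frontier (hsub (hseg 1 zero_le_one le_rfl)).1
  have hm := triSet_frontier (hsub (hseg (1/2) (by norm_num) (by norm_num))).1
  rw [zero_smul, add_zero] at h0
  rw [one_smul, add_sub_cancel] at h1
  have hmI := hm.2
  unfold In at hmI
  push Not at hmI
  obtain ⟨k, hk⟩ := hmI
  rw [co_comb] at hk
  have hkP := h0.1 k
  have hkQ := h1.1 k
  have hd : li (b i) k (Q - P) = 0 := by rw [li_sub]; linarith
  have hφ : φ (Q - P) ≠ 0 := by
    intro h
    rw [map_sub] at h
    obtain ⟨t, ht⟩ := G.ker P Q (by linarith)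
    rw [ht, add_sub_cancel_left, map_smul, smul_eq_mul] at hd
    have := (mul_eq_zero.1 hd).resolve_right (G.li_ne i k)
    rw [this] at ht
    simp at ht
    exact hPQ ht.symm
  obtain ⟨t, t0, t1, g⟩ := exists_gen b φ P _ hφ one_pos
  have hq := hsub (hseg t t0.le t1.le)
  exact col_cross' H G K g hij (triSet_frontier hq.1).1 (triSet_frontier hq.2).1

lemma tilesAt_one {tiles : Fin N → Tri} {P : Pt} (h : (tilesAt tiles P).card = 1)
    {i j : Fin N} (hi : ∃ k, tiles i k = P) (hj : ∃ k, tiles j k = P) : i = j := by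
  refine Finset.card_le_one.1 h.le i ?_ j ?_
  · simpa [tilesAt] using hi
  · simpa [tilesAt] using hj

lemma Gen.lic_ne (G : Gen b c u φ) (k : Fin 3) : li c k u ≠ 0 := by
  fin_cases k
  · exact G.l0.ne'
  · exact G.l1.ne
  · exact G.l2.ne

lemma Gen.li_neg (G : Gen b c u φ) (i : Fin N) (k : Fin 3) : li (b i) k (-u) ≠ 0 := by
  rw [map_neg]; exact neg_ne_zero.2 (G.li_ne i k)

lemma evenAt (H : Til b c) (G : Gen b c u φ)
    (hA : (tilesAt (fun i => ⇑(b i)) (c 0)).card = 1)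
    (hbdry : ∀ P : Pt, IsTilingVertex (fun i => ⇑(b i)) P → angleSumAt (fun i => ⇑(b i)) P = π →
      Odd (tilesAt (fun i => ⇑(b i)) P).card)
    (hint : ∀ P : Pt, IsTilingVertex (fun i => ⇑(b i)) P →
      angleSumAt (fun i => ⇑(b i)) P = 2 * π → Even (tilesAt (fun i => ⇑(b i)) P).card) :
    EvenAt b c u := by
  intro P hP h1 h2
  by_cases h0 : P = c 0
  · subst h0
    have hD : Dir c (c 0) (-u) := by
      refine (forall_cyc 0).2 ⟨Or.inl ?_, Or.inr ⟨?_, ?_⟩, Or.inr ⟨?_, ?_⟩⟩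
      · rw [co_self]; norm_num
      · exact co_ne _ (by decide)
      · rw [map_neg]; exact neg_pos.2 G.l1
      · exact co_ne _ (by decide)
      · rw [map_neg]; exact neg_pos.2 G.l2
    obtain ⟨i, hi⟩ := H.dir_exists G.li_neg hD
    have hi' := H.extreme hi.cl
    have : nonmid b u (c 0) = ∅ := by
      refine Finset.eq_empty_of_forall_notMem fun j hj => ?_
      simp only [nonmid, Finset.mem_filter, Finset.mem_univ, true_and] at hj
      have := tilesAt_one hA hi' hj.1
      subst this
      exact hj.2.2 hi
    rw [this]
    simp
  · refine H.nonmid_even hP G.li_ne G.lic_ne (hbdry P hP) (hint P hP) ?_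
    intro k
    fin_cases k
    · exact fun h => h0 h.symm
    · exact fun h => h1 h.symm
    · exact fun h => h2 h.symm

lemma col_A (H : Til b c) (G : Gen b c u φ) {κ : Fin N → ZMod 2} (K : IsCol b u φ κ)
    (hA : (tilesAt (fun i => ⇑(b i)) (c 0)).card = 1) {i : Fin N} (hi : ∃ k, b i k = c 0) :
    κ i = 1 := by
  have h1 : ∀ᶠ t : ℝ in nhdsWithin 0 (Set.Ioi 0), ∀ j, j ≠ i → ¬ Cl (b j) (c 0 + t • (c 2 - c 0)) := by
    rw [Filter.eventually_all]
    intro j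
    by_cases hj : j = i
    · exact Filter.Eventually.of_forall fun t h => absurd hj h
    have h2 : ¬ Cl (b j) (c 0) := fun h => hj (tilesAt_one hA (H.extreme h) hi)
    unfold Cl at h2
    push Not at h2
    obtain ⟨k, hk⟩ := h2
    have hc : Continuous fun t : ℝ => co (b j) k (c 0) + t * li (b j) k (c 2 - c 0) := by fun_prop
    have h3 := hc.tendsto 0
    simp only [zero_mul, add_zero] at h3
    have h4 := (h3.eventually (gt_mem_nhds hk)).filter_mono (nhdsWithin_le_nhds (s := Set.Ioi 0))
    filter_upwards [h4] with t ht _ hcl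
    have := hcl k
    rw [co_line] at this
    linarith
  have h4 : ∀ᶠ s : ℝ in nhdsWithin 0 (Set.Ioi 0), s ∈ Set.Ioo (0:ℝ) 1 := Ioo_mem_nhdsGT one_pos
  obtain ⟨ε, hε, hsub⟩ := mem_nhdsGT_iff_exists_Ioo_subset.1 (h1.and h4)
  have hφ : φ (c 2 - c 0) ≠ 0 := by rw [map_sub]; linarith [G.o2]
  obtain ⟨t, t0, t1, g⟩ := exists_gen b φ (c 0) _ hφ hε
  obtain ⟨h5, -, h6⟩ := hsub ⟨t0, t1⟩
  set q := c 0 + t • (c 2 - c 0) with hq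
  have e0 : co c 0 q = 1 - t := by
    rw [hq, co_comb, co_self, co_ne _ (by decide)]; ring
  have e1 : co c 1 q = 0 := by
    rw [hq, co_comb, co_ne _ (by decide), co_ne _ (by decide)]; ring
  have e2 : co c 2 q = t := by
    rw [hq, co_comb, co_self, co_ne _ (by decide)]; ring
  have hD : Dir c q (-u) := by
    refine (forall_cyc 0).2 ⟨Or.inl ?_, Or.inr ⟨e1, ?_⟩, Or.inl ?_⟩
    · rw [e0]; linarith
    · rw [map_neg]; exact neg_pos.2 G.l1
    · change 0 < co c 2 q
      rw [e2]; exact t0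
  have hnD : ¬ Dir c q u := by
    intro h
    rcases h 1 with h | h
    · linarith
    · linarith [h.2, G.l1]
  obtain ⟨j, hj⟩ := H.dir_exists G.li_neg hD
  have : j = i := by
    by_contra hne
    exact h5 j hne hj.cl
  subst this
  exact col_top H G K g hj hnD

def sg (x : ZMod 2) : ℝ := if x = 1 then 1 else -1

lemma sg_add {x y : ZMod 2} (h : x ≠ y) : sg x + sg y = 0 := by
  unfold sg
  have h2 : x = 1 ∧ y = 0 ∨ x = 0 ∧ y = 1 := by revert x y; decide
  rcases h2 with ⟨rfl, rfl⟩ | ⟨rfl, rfl⟩ <;> simp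

/-- The pointwise identity, tile side. -/
lemma pt_id (H : Til b c) (G : Gen b c u φ) (E : EvenAt b c u) {κ : Fin N → ZMod 2}
    (K : IsCol b u φ κ) {q : Pt} (g : GenPt b φ q) :
    (∑ i, if Flat (b i) q then sg (κ i) else 0) =
      if Flat c q then
        (if co c 0 q = 0 then sg ((tilesAt (fun i => ⇑(b i)) (c 1)).card : ZMod 2) else 1)
      else 0 := by
  by_cases hcl : Cl c q
  swap
  · rw [if_neg fun h => hcl h.cl]
    refine Finset.sum_eq_zero fun i _ => if_neg fun h => hcl ((H.cover q).2 ⟨i, h.cl⟩)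
  rcases cl_cases hcl with hI | hF | ⟨k, hk⟩
  · rw [if_neg fun h => h.not_In hI]
    obtain ⟨i, hi⟩ := H.dir_exists G.li_ne (hI.dir u)
    obtain ⟨j, hj⟩ := H.dir_exists G.li_neg (hI.dir (-u))
    by_cases hij : i = j
    · subst hij
      have hin : In (b i) q := by
        by_contra h
        exact not_both_dir h ⟨hi, hj⟩
      refine Finset.sum_eq_zero fun l _ => if_neg fun h => ?_
      have := H.disj' hin h.cl
      subst this
      exact h.not_In hin
    · have fi := (g.cases hi.cl).resolve_left fun h => hij (H.disj' h hj.cl)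
      have fj := (g.cases hj.cl).resolve_left fun h => hij (H.disj' h hi.cl).symm
      rw [Fintype.sum_eq_add i j hij, if_pos fi, if_pos fj, sg_add (col_cross H G K g hij hi hj)]
      rintro l ⟨li', lj⟩
      refine if_neg fun h => ?_
      rcases flat_dir h (G.li_ne l) with h | h
      · exact li' (H.dir_unique h.1 hi)
      · exact lj (H.dir_unique h.2 hj)
  · rw [if_pos hF]
    have nI : ∀ i, ¬ In (b i) q := fun i h => hF.not_In (H.sub _ _ h)
    obtain ⟨k, h0, h1, h2⟩ := hF
    rcases flat_dir ⟨k, h0, h1, h2⟩ G.lic_ne with hd | hd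
    · obtain ⟨i, hi⟩ := H.dir_exists G.li_ne hd.1
      have fi := (g.cases hi.cl).resolve_left (nI i)
      rw [Fintype.sum_eq_single i, if_pos fi, col_up H G K g hi]
      · have hk : k = 0 := by
          have := (hd.1 k).resolve_left h0.le.not_gt
          have l1 := G.l1
          have l2 := G.l2
          rcases this with ⟨-, h⟩
          revert h
          fin_cases k
          · simp
          · intro h; exact absurd h l1.le.not_gt
          · intro h; exact absurd h l2.le.not_gt
        subst hk
        rw [if_pos h0, cnt_bot H G E g hcl h0]
      · intro l hl
        refine if_neg fun h => ?_
        rcases flat_dir h (G.li_ne l) with h | h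
        · exact hl (H.dir_unique h.1 hi)
        · exact hd.2 (H.dir_sub h.2)
    · obtain ⟨i, hi⟩ := H.dir_exists G.li_neg hd.2
      have fi := (g.cases hi.cl).resolve_left (nI i)
      rw [Fintype.sum_eq_single i, if_pos fi, col_top H G K g hi hd.1]
      · rw [if_neg]
        · simp [sg]
        · intro h
          have := (hd.2 0).resolve_left h.le.not_gt
          rw [map_neg] at this
          linarith [this.2, G.l0]
      · intro l hl
        refine if_neg fun h => ?_
        rcases flat_dir h (G.li_ne l) with h | h
        · exact hd.1 (H.dir_sub h.1)
        · exact hl (H.dir_unique h.2 hi)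
  · exfalso
    obtain ⟨i, l, h⟩ := H.c_vertex k
    exact g i l (by rw [h, hk])

end

section
variable {N : ℕ} {b : Fin N → Bas} {c : Bas} {u : Pt} {φ : Pt →ₗ[ℝ] ℝ}

open MeasureTheory in
lemma step_int {ι : Type*} [Fintype ι] (f : ι → ℝ) (x y : ι → Pt) (D : Set Pt) (hD : D.Finite)
    (h : ∀ q, q ∉ D → ∑ i, f i * (segment ℝ (x i) (y i)).indicator (fun _ => (1:ℝ)) q = 0) :
    ∑ i, f i * dist (x i) (y i) = 0 := by
  set μ : Measure Pt := Measure.hausdorffMeasure 1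
  have : NullSingletonClass μ := Measure.nullSingletonClass_hausdorff Pt one_pos
  have hms : ∀ i, MeasurableSet (segment ℝ (x i) (y i)) := fun i =>
    (by
      rw [← convexHull_pair]
      exact ((Set.toFinite _).isCompact_convexHull (𝕜 := ℝ)).isClosed.measurableSet)
  have hμ : ∀ i, μ (segment ℝ (x i) (y i)) = edist (x i) (y i) := fun i =>
    hausdorffMeasure_segment _ _
  have h0 : ∫ q, ∑ i, f i * (segment ℝ (x i) (y i)).indicator (fun _ => (1:ℝ)) q ∂μ = 0 := by
    apply integral_eq_zero_of_ae
    have : ∀ᵐ q ∂μ, q ∉ D := hD.countable.ae_notMem μ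
    filter_upwards [this] with q hq using h q hq
  rw [integral_finsetSum] at h0
  · rw [← h0]
    refine Finset.sum_congr rfl fun i _ => ?_
    rw [integral_const_mul, integral_indicator_const _ (hms i), measureReal_def, hμ i, edist_dist,
      ENNReal.toReal_ofReal dist_nonneg]
    simp
  · intro i _
    apply Integrable.const_mul
    refine (integrable_indicator_iff (hms i)).2 ?_
    refine integrableOn_const ?_
    rw [hμ i]; exact edist_ne_top _ _

lemma mem_edge (b : Bas) (k : Fin 3) (q : Pt) :
    q ∈ segment ℝ (b (k+1)) (b (k+2)) ↔ Cl b q ∧ co b k q = 0 := by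
  have n1 : k ≠ k + 1 := by fin_cases k <;> simp
  have n2 : k ≠ k + 2 := by fin_cases k <;> simp
  constructor
  · rw [segment_eq_image']
    rintro ⟨t, ⟨t0, t1⟩, rfl⟩
    refine ⟨Cl.comb (vertex_cl _ _) (vertex_cl _ _) t0 t1, ?_⟩
    rw [co_comb, co_ne _ n1, co_ne _ n2]; ring
  · rintro ⟨h1, h2⟩
    have h3 := co_repr b k q
    rw [h2, zero_smul, zero_add] at h3
    have h4 := co_sum' b k q
    exact ⟨_, _, h1 (k+1), h1 (k+2), by linarith, h3.symm⟩

lemma fin_three : ∀ n m : Fin 3, n = m ∨ n = m + 1 ∨ n = m + 2 := by decide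

lemma edge_sum (b : Bas) {q : Pt} (hq : ∀ k, b k ≠ q) (s : Fin 3 → ℝ) :
    ((¬ Flat b q) → ∑ k, s k * (segment ℝ (b (k+1)) (b (k+2))).indicator (fun _ => (1:ℝ)) q = 0) ∧
    (∀ k, co b k q = 0 → Flat b q →
      ∑ k, s k * (segment ℝ (b (k+1)) (b (k+2))).indicator (fun _ => (1:ℝ)) q = s k) := by
  simp only [Set.indicator_apply, mem_edge]
  constructor
  · intro hf
    refine Finset.sum_eq_zero fun k _ => ?_
    rw [if_neg, mul_zero]
    rintro ⟨h1, h2⟩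
    rcases cl_cases h1 with h | h | ⟨l, h⟩
    · exact (h k).ne' h2
    · exact hf h
    · exact hq l h
  · intro k hk hf
    rw [Fintype.sum_eq_single k, if_pos ⟨hf.cl, hk⟩, mul_one]
    intro l hl
    rw [if_neg, mul_zero]
    rintro ⟨h1, h2⟩
    obtain ⟨m, h3, h4, h5⟩ := hf
    have e : ∀ n, co b n q = 0 → n = m := by
      intro n hn
      have : n = m ∨ n = m + 1 ∨ n = m + 2 := fin_three n m
      rcases this with h | rfl | rfl
      · exact h
      · linarith
      · linarith
    exact hl ((e l h2).trans (e k hk).symm)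

lemma nongen_seg (b : Fin N → Bas) (φ : Pt →ₗ[ℝ] ℝ) (P Q : Pt) (h : φ P ≠ φ Q) :
    {q | q ∈ segment ℝ P Q ∧ ¬ GenPt b φ q}.Finite := by
  refine ((nongen_finite b φ P (Q - P) ?_).image (fun t => P + t • (Q - P))).subset ?_
  · rw [map_sub]; exact fun h' => h (by linarith)
  · rintro q ⟨hq, hg⟩
    rw [segment_eq_image'] at hq
    obtain ⟨t, -, rfl⟩ := hq
    exact ⟨t, hg, rfl⟩

lemma edge_eq (H : Til b c) (G : Gen b c u φ) (E : EvenAt b c u) {κ : Fin N → ZMod 2}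
    (K : IsCol b u φ κ) :
    ∑ i, sg (κ i) * ∑ k, sideLen (b i) k =
      sg ((tilesAt (fun i => ⇑(b i)) (c 1)).card : ZMod 2) * sideLen c 0 +
        sideLen c 1 + sideLen c 2 := by
  set s : ℝ := sg ((tilesAt (fun i => ⇑(b i)) (c 1)).card : ZMod 2)
  let w : Fin 3 → ℝ := fun k => if k = 0 then s else 1
  let f : (Fin N × Fin 3) ⊕ Fin 3 → ℝ := Sum.elim (fun x => sg (κ x.1)) (fun k => - w k)
  let x : (Fin N × Fin 3) ⊕ Fin 3 → Pt := Sum.elim (fun x => b x.1 (x.2 + 1)) (fun k => c (k+1))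
  let y : (Fin N × Fin 3) ⊕ Fin 3 → Pt := Sum.elim (fun x => b x.1 (x.2 + 2)) (fun k => c (k+2))
  have n3 : ∀ k : Fin 3, k + 1 ≠ k + 2 := by decide
  have hφ : ∀ z, φ (x z) ≠ φ (y z) := by
    rintro (⟨i, k⟩ | k)
    · exact fun h => n3 k (G.inj1 i _ _ h)
    · change φ (c (k+1)) ≠ φ (c (k+2))
      obtain ⟨i, l, h⟩ := H.c_vertex (k+1)
      obtain ⟨j, m, h'⟩ := H.c_vertex (k+2)
      intro he
      rw [← h, ← h'] at he
      have := G.inj _ _ _ _ he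
      rw [h, h'] at this
      exact n3 k (c.ind.injective this)
  have main := step_int f x y (⋃ z, {q | q ∈ segment ℝ (x z) (y z) ∧ ¬ GenPt b φ q})
    (Set.finite_iUnion fun z => nongen_seg b φ _ _ (hφ z)) ?_
  · rw [Fintype.sum_sum_type, Fintype.sum_prod_type] at main
    simp only [f, x, y, w, Sum.elim_inl, Sum.elim_inr] at main
    rw [Fin.sum_univ_three (fun k : Fin 3 => -(if k = 0 then s else 1) * dist (c (k+1)) (c (k+2)))] at main
    simp only [if_true, show (1 : Fin 3) ≠ 0 by decide, show (2 : Fin 3) ≠ 0 by decide, if_false] at main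
    simp only [Finset.mul_sum]
    unfold sideLen
    linarith
  · intro q hq
    by_cases g : GenPt b φ q
    · rw [Fintype.sum_sum_type, Fintype.sum_prod_type]
      simp only [f, x, y, Sum.elim_inl, Sum.elim_inr]
      have h1 : ∀ i, ∑ k, sg (κ i) * (segment ℝ (b i (k+1)) (b i (k+2))).indicator (fun _ => (1:ℝ)) q
          = if Flat (b i) q then sg (κ i) else 0 := by
        intro i
        have h2 := edge_sum (b i) (q := q) (fun k h => g i k (by rw [h])) (fun _ => sg (κ i))
        split_ifs with hf
        · obtain ⟨k, hk⟩ := id hf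
          exact h2.2 k hk.1 hf
        · exact h2.1 hf
      rw [Finset.sum_congr rfl fun i _ => h1 i, pt_id H G E K g]
      have h2 := edge_sum c (q := q) (fun k h => by
        obtain ⟨i, l, h'⟩ := H.c_vertex k
        exact g i l (by rw [h', h])) (fun k => - w k)
      split_ifs with hf hz
      · rw [h2.2 0 hz hf]
        simp [w, s]
      · obtain ⟨k, hk⟩ := id hf
        rw [h2.2 k hk.1 hf]
        have : k ≠ 0 := by rintro rfl; exact hz hk.1
        simp [w, this]
      · rw [h2.1 hf]; simp
    · refine Finset.sum_eq_zero fun z _ => ?_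
      rw [Set.indicator_of_notMem, mul_zero]
      intro hz
      exact hq (Set.mem_iUnion.2 ⟨z, hz, g⟩)

end

section
variable {N : ℕ}

def gu (c : Bas) (s : ℝ) : Pt := (1 - s) • (c 0 - c 1) + s • (c 0 - c 2)
def gφ (c : Bas) (s : ℝ) : Pt →ₗ[ℝ] ℝ := (1 - s) • li c 2 - s • li c 1

lemma gφ_apply (c : Bas) (s : ℝ) (d : Pt) : gφ c s d = (1 - s) * li c 2 d - s * li c 1 d := rfl

lemma gu0 (c : Bas) (s : ℝ) : li c 0 (gu c s) = 1 := by
  unfold gu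
  rw [map_add, map_smul, map_smul, li_sub, li_sub, co_self, co_ne _ (by decide), co_ne _ (by decide)]
  simp

lemma gu1 (c : Bas) (s : ℝ) : li c 1 (gu c s) = -(1 - s) := by
  unfold gu
  rw [map_add, map_smul, map_smul, li_sub, li_sub, co_self, co_ne _ (by decide), co_ne _ (by decide)]
  simp

lemma gu2 (c : Bas) (s : ℝ) : li c 2 (gu c s) = -s := by
  unfold gu
  rw [map_add, map_smul, map_smul, li_sub, li_sub, co_self, co_ne _ (by decide), co_ne _ (by decide)]
  simp

lemma li_zero (c : Bas) {d : Pt} (h1 : li c 1 d = 0) (h2 : li c 2 d = 0) : d = 0 := by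
  have h := li_sum' c 0 d
  change li c 0 d + li c 1 d + li c 2 d = 0 at h
  have h0 : li c 0 d = 0 := by linarith
  have h3 := li_repr c 0 d
  change d = li c 0 d • c 0 + li c 1 d • c 1 + li c 2 d • c 2 at h3
  rw [h0, h1, h2] at h3
  simpa using h3

lemma exists_Gen (b : Fin N → Bas) (c : Bas) : ∃ u φ, Gen b c u φ := by
  have hfin : (⋃ x : (Fin N × Fin 3) × (Fin N × Fin 3),
      {s : ℝ | gφ c s (b x.1.1 x.1.2) = gφ c s (b x.2.1 x.2.2) ∧
        b x.1.1 x.1.2 ≠ b x.2.1 x.2.2}).Finite := by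
    refine Set.finite_iUnion fun x => Set.Subsingleton.finite ?_
    rintro s ⟨hs, hne⟩ t ⟨ht, -⟩
    by_contra hst
    apply hne
    rw [← sub_eq_zero] at hs ht ⊢
    rw [← map_sub, gφ_apply] at hs ht
    set d := b x.1.1 x.1.2 - b x.2.1 x.2.2
    have h1 : (s - t) * (li c 1 d + li c 2 d) = 0 := by linear_combination ht - hs
    have h2 := (mul_eq_zero.1 h1).resolve_left (sub_ne_zero.2 hst)
    have h3 : li c 2 d = 0 := by linear_combination hs + s * h2
    exact li_zero c (by linarith) h3
  obtain ⟨s, ⟨s0, s1⟩, hs⟩ := ((Set.Ioo_infinite (zero_lt_one' ℝ)).sdiff hfin).nonempty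
  have e : ∀ k, gφ c s (c k) = gφ c s 0 - ((1 - s) * co c 2 0 - s * co c 1 0) +
      ((1 - s) * co c 2 (c k) - s * co c 1 (c k)) := by
    intro k
    have h1 := co_add c 1 0 (c k)
    have h2 := co_add c 2 0 (c k)
    rw [zero_add] at h1 h2
    rw [map_zero, gφ_apply, h1, h2]; ring
  refine ⟨gu c s, gφ c s, ?_, ?_, ?_, ?_, ?_, ?_, ?_, ?_⟩
  · rw [gφ_apply, gu1, gu2]; ring
  · intro p q hpq
    refine ⟨li c 0 (q - p), ?_⟩
    have h := li_sum' c 0 (q - p)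
    change li c 0 (q - p) + li c 1 (q - p) + li c 2 (q - p) = 0 at h
    have h1 : gφ c s (q - p) = 0 := by rw [map_sub, hpq, sub_self]
    rw [gφ_apply] at h1
    have h2 : (q - p) - li c 0 (q - p) • gu c s = 0 := by
      apply li_zero c
      · rw [map_sub (li c 1) (q - p) (li c 0 (q - p) • gu c s), map_smul, gu1, smul_eq_mul]
        linear_combination (1 - s) * h - h1
      · rw [map_sub (li c 2) (q - p) (li c 0 (q - p) • gu c s), map_smul, gu2, smul_eq_mul]
        linear_combination s * h + h1
    rw [sub_eq_zero] at h2
    rw [← h2]; abel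
  · intro i k j l h
    by_contra hne
    exact hs (Set.mem_iUnion.2 ⟨((i, k), (j, l)), h, hne⟩)
  · rw [gu0]; norm_num
  · rw [gu1]; linarith
  · rw [gu2]; linarith
  · rw [e 1, e 0, co_self, co_ne c (k := 2) (l := 1) (by decide), co_ne c (k := 2) (l := 0) (by decide),
      co_ne c (k := 1) (l := 0) (by decide)]
    linarith
  · rw [e 2, e 0, co_self, co_ne c (k := 1) (l := 2) (by decide), co_ne c (k := 2) (l := 0) (by decide),
      co_ne c (k := 1) (l := 0) (by decide)]
    linarith

def mkBas (T : Tri) (h : AffineIndependent ℝ T) : Bas :=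
  ⟨T, h, by rw [h.affineSpan_eq_top_iff_card_eq_finrank_add_one]; simp⟩

lemma mkBas_coe (T : Tri) (h : AffineIndependent ℝ T) : ⇑(mkBas T h) = T := rfl

lemma ind_of_congr {S T : Tri} (h : CongruentTri S T) (hT : AffineIndependent ℝ T) :
    AffineIndependent ℝ S := by
  obtain ⟨σ, hσ⟩ := h
  rw [affineIndependent_iff_not_collinear]
  intro hc
  have hr : Set.range S = {S 0, S 1, S 2} := by
    ext x
    simp only [Set.mem_range, Fin.exists_fin_succ, Set.mem_insert_iff, Set.mem_singleton_iff]
    simp [eq_comm]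
  rw [hr] at hc
  have key : ∀ i j k : Fin 3, Function.Injective ![i, j, k] → ¬ Wbtw ℝ (S i) (S j) (S k) := by
    intro i j k hi hw
    rw [← dist_add_dist_eq_iff, hσ, hσ, hσ, dist_add_dist_eq_iff] at hw
    refine AffineIndependent.not_wbtw_of_injective (σ i) (σ j) (σ k) ?_ hT hw
    have : ![σ i, σ j, σ k] = σ ∘ ![i, j, k] := by
      ext x; fin_cases x <;> rfl
    rw [this]
    exact σ.injective.comp hi
  rcases hc.wbtw_or_wbtw_or_wbtw with h | h | h
  · exact key _ _ _ (by decide) h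
  · exact key _ _ _ (by decide) h
  · exact key _ _ _ (by decide) h

lemma perim_eq (T : Tri) : 2 * ∑ k, sideLen T k = ∑ i, ∑ j, dist (T i) (T j) := by
  simp only [Fin.sum_univ_three, sideLen, dist_self]
  change 2 * (dist (T 1) (T 2) + dist (T 2) (T 0) + dist (T 0) (T 1)) = _
  rw [dist_comm (T 1) (T 0), dist_comm (T 0) (T 2), dist_comm (T 2) (T 1)]
  ring

lemma perim_congr {S T : Tri} (h : CongruentTri S T) : ∑ k, sideLen S k = ∑ k, sideLen T k := by
  obtain ⟨σ, hσ⟩ := h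
  have : ∑ i, ∑ j, dist (S i) (S j) = ∑ i, ∑ j, dist (T i) (T j) := by
    rw [← Equiv.sum_comp σ (fun i => ∑ j, dist (T i) (T j))]
    refine Finset.sum_congr rfl fun i _ => ?_
    rw [← Equiv.sum_comp σ (fun j => dist (T (σ i)) (T j))]
    exact Finset.sum_congr rfl fun j _ => hσ i j
  rw [← perim_eq, ← perim_eq] at this
  linarith

lemma mk_til {T : Tri} {b : Fin N → Bas} {c : Bas} (ht : IsTiling N c T (fun i => ⇑(b i))) :
    Til b c := by
  have hcov : ∀ p, Cl c p ↔ ∃ i, Cl (b i) p := by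
    intro p
    have := Set.ext_iff.1 ht.cover p
    simp only [Set.mem_iUnion, triSet_eq] at this
    exact this.symm
  refine ⟨?_, hcov, ?_⟩
  · intro i j p hi hj
    by_contra hij
    have h := ht.disj i j hij
    simp only [triSet_interior] at h
    have h2 : p ∈ {p | In (b i) p} ∩ {p | In (b j) p} := ⟨hi, hj⟩
    rw [h] at h2
    exact h2
  · intro i p hp
    have h1 : triSet (b i) ⊆ triSet c := by
      rw [← ht.cover]
      exact Set.subset_iUnion (fun i => triSet (b i)) i
    have h2 := interior_mono h1
    rw [triSet_interior, triSet_interior] at h2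
    exact h2 hp

lemma sum_sg (κ : Fin N → ZMod 2) : ∑ i, sg (κ i) =
    ((Finset.univ.filter fun i : Fin N => decide (κ i = 1) = true).card : ℝ) -
        ((Finset.univ.filter fun i : Fin N => decide (κ i = 1) = false).card : ℝ) := by
  rw [Finset.card_filter, Finset.card_filter]
  push_cast
  rw [← Finset.sum_sub_distrib]
  refine Finset.sum_congr rfl fun i _ => ?_
  unfold sg
  by_cases h : κ i = 1 <;> simp [h]

end

/-- **The coloring theorem.**  Suppose triangle `ABC` is `N`-tiled by a tile
with sides `a`, `b`, `c` so that (i) exactly one tile has a vertex at `A`,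
(ii) at every boundary vertex (angle sum `π`) an odd number of tiles meet,
(iii) at every interior vertex (angle sum `2π`) an even number of tiles meet,
and (iv) the numbers of tiles at `B` and at `C` have the same parity.
Then the tiles can be two-colored, with colors changing across tile
boundaries and the tile at `A` black; and with `M` the number of black tiles
minus the number of white tiles, `X ± Y + Z = M(a + b + c)`, where `Y` is the
side of `ABC` opposite `A`, `X`, `Z` are the other two sides, the sign being
`+` if the numbers of tiles at `B` and at `C` are odd and `−` if they are
even. -/
theorem coloring_equation (N : ℕ) (ABC T : Tri)
    (hABC : IsTriangle ABC) (hT : IsTriangle T)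
    (tiles : Fin N → Tri) (ht : IsTiling N ABC T tiles)
    (hA : (tilesAt tiles (ABC 0)).card = 1)
    (hbdry : ∀ P : Pt, IsTilingVertex tiles P → angleSumAt tiles P = π →
      Odd (tilesAt tiles P).card)
    (hint : ∀ P : Pt, IsTilingVertex tiles P → angleSumAt tiles P = 2 * π →
      Even (tilesAt tiles P).card)
    (hBC : Even (tilesAt tiles (ABC 1)).card ↔ Even (tilesAt tiles (ABC 2)).card) :
    ∃ color : Fin N → Bool,
      (∀ i j : Fin N, i ≠ j → SharesEdgeSegment tiles i j → color i ≠ color j) ∧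
      (∀ i ∈ tilesAt tiles (ABC 0), color i = true) ∧
      (let M : ℝ := ((Finset.univ.filter fun i : Fin N => color i = true).card : ℝ) -
        ((Finset.univ.filter fun i : Fin N => color i = false).card : ℝ)
       let X : ℝ := dist (ABC 0) (ABC 1)
       let Y : ℝ := dist (ABC 1) (ABC 2)
       let Z : ℝ := dist (ABC 0) (ABC 2)
       (Odd (tilesAt tiles (ABC 1)).card ∧ Odd (tilesAt tiles (ABC 2)).card →
          X + Y + Z = M * (sideLen T 0 + sideLen T 1 + sideLen T 2)) ∧
       (Even (tilesAt tiles (ABC 1)).card ∧ Even (tilesAt tiles (ABC 2)).card →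
          X - Y + Z = M * (sideLen T 0 + sideLen T 1 + sideLen T 2))) := by
  have hind : ∀ i, AffineIndependent ℝ (tiles i) := fun i => ind_of_congr (ht.congr i) hT
  obtain ⟨b, hb⟩ : ∃ b : Fin N → Bas, tiles = fun i => ⇑(b i) :=
    ⟨fun i => mkBas (tiles i) (hind i), rfl⟩
  obtain ⟨c, hc⟩ : ∃ c : Bas, ABC = ⇑c := ⟨mkBas ABC hABC, rfl⟩
  subst hb hc
  have H := mk_til ht
  obtain ⟨u, φ, G⟩ := exists_Gen b c
  have E := evenAt H G hA hbdry hint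
  obtain ⟨κ, K⟩ := exists_col H G E
  refine ⟨fun i => decide (κ i = 1), ?_, ?_, ?_⟩
  · intro i j hij hs heq
    have h1 := col_shares H G K hij hs
    have h2 : ∀ x y : ZMod 2, x ≠ y → ¬ (x = 1 ↔ y = 1) := by decide
    exact h2 _ _ h1 (by simpa using heq)
  · intro i hi
    have : ∃ k, b i k = c 0 := by simpa [tilesAt] using hi
    simpa using col_A H G K hA this
  · intro M X Y Z
    have h1 := edge_eq H G E K
    have h2 : ∀ i, ∑ k, sideLen (b i) k = ∑ k, sideLen T k := fun i => perim_congr (ht.congr i)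
    simp only [h2] at h1
    rw [← Finset.sum_mul, sum_sg, Fin.sum_univ_three] at h1
    have hM : M * (sideLen T 0 + sideLen T 1 + sideLen T 2) =
      sg ((tilesAt (fun i => ⇑(b i)) (c 1)).card : ZMod 2) * Y + Z + X := by
      refine h1.trans ?_
      have e1 : sideLen c 1 = Z := dist_comm _ _
      have e2 : sideLen c 2 = X := rfl
      have e0 : sideLen c 0 = Y := rfl
      rw [e0, e1, e2]
    rw [hM]
    constructor
    · rintro ⟨h3, -⟩
      rw [(ZMod.natCast_eq_one_iff_odd).2 h3]
      simp only [sg, if_true]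
      ring
    · rintro ⟨h3, -⟩
      rw [(ZMod.natCast_eq_zero_iff_even).2 h3]
      simp only [sg, show (0 : ZMod 2) ≠ 1 by decide, if_false]
      ring
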